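/- Let A be a finite Taylor algebra and ρ ∈ Con(A) meet-irreducible with unique upper cover ρ⁺ such that ρ⁺/ρ is abelian. Then Cov⁺(ρ) = {ρ⁺}, and T^opt_{(A,ρ)} is an optimal bridge from (A,ρ) to itself, i.e., a good bridge from (A,ρ) to (A,ρ) whose trace equals Opt(ρ) = (ρ : ρ⁺). -/

import Mathlib

namespace Zhuk

/-- A signature: a type of operation symbols with arities. -/
structure Signature where
  ops : Type
  arity : ops → ℕ

/-- An algebra structure of signature `S` on carrier `A`. -/
class SAlg (S : Signature) (A : Type) where
  interp : (o : S.ops) → (Fin (S.arity o) → A) → A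

variable {S : Signature}

/-- Componentwise algebra structure on a product. -/
instance prodSAlg {A B : Type} [SAlg S A] [SAlg S B] : SAlg S (A × B) :=
  ⟨fun o x => (SAlg.interp o fun i => (x i).1, SAlg.interp o fun i => (x i).2)⟩

/-- A subset closed under all the operations. -/
def IsSubuniverse (S : Signature) {A : Type} [SAlg S A] (R : Set A) : Prop :=
  ∀ (o : S.ops) (x : Fin (S.arity o) → A), (∀ i, x i ∈ R) → SAlg.interp o x ∈ R

/-- The algebra structure on (the subtype of) a subuniverse. -/
def subAlg {A : Type} [SAlg S A] (R : Set A) (h : IsSubuniverse S R) : SAlg S ↥R :=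
  ⟨fun o x => ⟨SAlg.interp o fun i => (x i).1, h o _ fun i => (x i).2⟩⟩

/-- Terms of signature `S` in `n` variables. -/
inductive STerm (S : Signature) (n : ℕ) : Type
  | var : Fin n → STerm S n
  | app (o : S.ops) : (Fin (S.arity o) → STerm S n) → STerm S n

/-- Evaluation of a term in an algebra. -/
def STerm.eval {A : Type} [SAlg S A] {n : ℕ} : STerm S n → (Fin n → A) → A
  | .var i, v => v i
  | .app o ts, v => SAlg.interp o fun i => (ts i).eval v

/-- The diagonal (smallest) congruence `0_A`. -/
def diag (A : Type) : Set (A × A) := {p | p.1 = p.2}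

/-- Relational composition. -/
def rcomp {A B C : Type} (R : Set (A × B)) (T : Set (B × C)) : Set (A × C) :=
  {p | ∃ b, (p.1, b) ∈ R ∧ (b, p.2) ∈ T}

/-- Relational inverse. -/
def rinv {A B : Type} (R : Set (A × B)) : Set (B × A) := {p | (p.2, p.1) ∈ R}

/-- Transitive closure of a binary relation (as a set of pairs). -/
def transCl {A : Type} (R : Set (A × A)) : Set (A × A) :=
  {p | Relation.TransGen (fun a b => (a, b) ∈ R) p.1 p.2}

/-- `R` is stable under (saturated with respect to) `ρ`:  `R = ρ ∘ R ∘ ρ`. -/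
def Saturated {A : Type} (ρ R : Set (A × A)) : Prop := rcomp ρ (rcomp R ρ) = R

/-- A congruence: a subuniverse of `A²` which is an equivalence relation. -/
def IsCongruence (S : Signature) {A : Type} [SAlg S A] (θ : Set (A × A)) : Prop :=
  IsSubuniverse S θ ∧ Equivalence fun a b => (a, b) ∈ θ

/-- `ρ ∈ Con*(A)`: a congruence different from the full congruence `1_A`. -/
def ConStar (S : Signature) {A : Type} [SAlg S A] (ρ : Set (A × A)) : Prop :=
  IsCongruence S ρ ∧ ρ ≠ Set.univ

/-- The ternary centralizer relation `C(φ, θ; δ)`, via the term condition. -/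
def Centralizes (S : Signature) {A : Type} [SAlg S A] (φ θ δ : Set (A × A)) : Prop :=
  ∀ (n : ℕ) (t : STerm S (n + 1)) (a b : A) (c d : Fin n → A),
    (a, b) ∈ φ → (∀ i, (c i, d i) ∈ θ) →
    (t.eval (Fin.cons a c), t.eval (Fin.cons a d)) ∈ δ →
    (t.eval (Fin.cons b c), t.eval (Fin.cons b d)) ∈ δ

/-- The centralizer `(δ : θ)`: the largest congruence `φ` with `C(φ, θ; δ)`. -/
def centralizer (S : Signature) {A : Type} [SAlg S A] (δ θ : Set (A × A)) : Set (A × A) :=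
  ⋃₀ {φ | IsCongruence S φ ∧ Centralizes S φ θ δ}

/-- A congruence of the subalgebra `A(θ) ≤ A²`, viewed ambiently as a subset of
`(A×A) × (A×A)` whose field is `θ`. -/
def IsConOn (S : Signature) {A : Type} [SAlg S A] (θ : Set (A × A))
    (Δ : Set ((A × A) × (A × A))) : Prop :=
  Δ ⊆ θ ×ˢ θ ∧ IsSubuniverse S Δ ∧ (∀ p ∈ θ, (p, p) ∈ Δ) ∧
    (∀ p q, (p, q) ∈ Δ → (q, p) ∈ Δ) ∧ (∀ p q r, (p, q) ∈ Δ → (q, r) ∈ Δ → (p, r) ∈ Δ)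

/-- `Δ_{θ,α}`: the congruence of `A(θ)` generated by `{((a,a),(b,b)) : (a,b) ∈ α}`. -/
def DeltaCon (S : Signature) {A : Type} [SAlg S A] (θ α : Set (A × A)) :
    Set ((A × A) × (A × A)) :=
  ⋂₀ {Δ | IsConOn S θ Δ ∧ ∀ a b : A, (a, b) ∈ α → ((a, a), (b, b)) ∈ Δ}

/-- Projection of a quaternary relation to its first two coordinates. -/
def pr12 {A B : Type} (T : Set (A × A × B × B)) : Set (A × A) :=
  {p | ∃ b₁ b₂, (p.1, p.2, b₁, b₂) ∈ T}

/-- Projection of a quaternary relation to its last two coordinates. -/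
def pr34 {A B : Type} (T : Set (A × A × B × B)) : Set (B × B) :=
  {q | ∃ a₁ a₂, (a₁, a₂, q.1, q.2) ∈ T}

/-- The trace of a quaternary relation. -/
def btr {A B : Type} (T : Set (A × A × B × B)) : Set (A × B) :=
  {p | (p.1, p.1, p.2, p.2) ∈ T}

/-- Zhuk's bridges: Definition 4.3 (B0*), (B1*), (B2*). -/
def IsBridge (S : Signature) {A B : Type} [SAlg S A] [SAlg S B]
    (ρ : Set (A × A)) (σ : Set (B × B)) (T : Set (A × A × B × B)) : Prop :=
  IsSubuniverse S T ∧
  (∀ a₁ a₂ b₁ b₂ a₁' a₂', (a₁, a₂, b₁, b₂) ∈ T → (a₁, a₁') ∈ ρ → (a₂, a₂') ∈ ρ →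
    (a₁', a₂', b₁, b₂) ∈ T) ∧
  (∀ a₁ a₂ b₁ b₂ b₁' b₂', (a₁, a₂, b₁, b₂) ∈ T → (b₁, b₁') ∈ σ → (b₂, b₂') ∈ σ →
    (a₁, a₂, b₁', b₂') ∈ T) ∧
  ρ ⊂ pr12 T ∧ σ ⊂ pr34 T ∧
  (∀ a₁ a₂ b₁ b₂, (a₁, a₂, b₁, b₂) ∈ T → ((a₁, a₂) ∈ ρ ↔ (b₁, b₂) ∈ σ))

/-- A bridge from `(A,ρ,L)` to `(B,σ,R)`: a bridge with prescribed anchors. -/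
def IsBridgeLR (S : Signature) {A B : Type} [SAlg S A] [SAlg S B]
    (ρ : Set (A × A)) (σ : Set (B × B)) (L : Set (A × A)) (R : Set (B × B))
    (T : Set (A × A × B × B)) : Prop :=
  IsBridge S ρ σ T ∧ pr12 T = L ∧ pr34 T = R

/-- A reflexive bridge (case `B = A`): `0_A ⊆ tr(T)`. -/
def ReflBridge {A : Type} (T : Set (A × A × A × A)) : Prop :=
  ∀ a : A, (a, a) ∈ btr T

/-- `Cov(ρ)`: the inclusion-minimal ρ-saturated subuniverses of `A²` properly containing ρ. -/
def Cov (S : Signature) {A : Type} [SAlg S A] (ρ : Set (A × A)) : Set (Set (A × A)) :=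
  {L | IsSubuniverse S L ∧ Saturated ρ L ∧ ρ ⊂ L ∧
    ∀ L', IsSubuniverse S L' → Saturated ρ L' → ρ ⊂ L' → L' ⊆ L → L' = L}

/-- `ref.tr(ρ,L)`: traces of reflexive bridges from `(A,ρ,L)` to itself. -/
def refTr (S : Signature) {A : Type} [SAlg S A] (ρ L : Set (A × A)) : Set (Set (A × A)) :=
  {γ | ∃ T : Set (A × A × A × A), IsBridgeLR S ρ ρ L L T ∧ ReflBridge T ∧ btr T = γ}

/-- `γ = Opt(ρ,L)`: `γ` is the (unique) inclusion-maximal member of `ref.tr(ρ,L)`. -/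
def IsOptOf (S : Signature) {A : Type} [SAlg S A] (ρ L γ : Set (A × A)) : Prop :=
  γ ∈ refTr S ρ L ∧ ∀ δ ∈ refTr S ρ L, γ ⊆ δ → δ = γ

/-- `ρ` is meet-irreducible with unique upper cover `ρplus`. -/
def MeetIrredWith (S : Signature) {A : Type} [SAlg S A] (ρ ρplus : Set (A × A)) : Prop :=
  IsCongruence S ρ ∧ ρ ≠ Set.univ ∧ IsCongruence S ρplus ∧ ρ ⊂ ρplus ∧
    ∀ θ, IsCongruence S θ → ρ ⊂ θ → ρplus ⊆ θ

/-- `Cov⁺(ρ) = {τ ∈ Cov(ρ) : τ ⊆ ρ⁺}`. -/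
def CovPlus (S : Signature) {A : Type} [SAlg S A] (ρ ρplus : Set (A × A)) :
    Set (Set (A × A)) :=
  {τ | τ ∈ Cov S ρ ∧ τ ⊆ ρplus}

/-- A good bridge between meet-irreducible congruences with upper covers `ρplus`, `σplus`. -/
def GoodBridge (S : Signature) {A B : Type} [SAlg S A] [SAlg S B]
    (ρ ρplus : Set (A × A)) (σ σplus : Set (B × B)) (T : Set (A × A × B × B)) : Prop :=
  IsBridge S ρ σ T ∧
    ∃ τ ∈ CovPlus S ρ ρplus, ∃ τ' ∈ CovPlus S σ σplus, ∃ T' ⊆ T,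
      IsBridgeLR S ρ σ τ τ' T' ∧ btr T' = btr T

/-- `t` (with Taylor-identity data `u v`) is idempotent on `A` and satisfies the
corresponding identities on `A`. -/
def TaylorOn (S : Signature) (A : Type) [SAlg S A] {n : ℕ} (t : STerm S n)
    (u v : Fin n → Fin n → Fin 2) : Prop :=
  (∀ a : A, t.eval (fun _ => a) = a) ∧
    ∀ (i : Fin n) (x y : A),
      t.eval (fun j => if u i j = 0 then x else y) =
        t.eval (fun j => if v i j = 0 then x else y)

/-- `A` is a Taylor algebra. -/
def IsTaylorAlg (S : Signature) (A : Type) [SAlg S A] : Prop :=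
  ∃ (n : ℕ) (t : STerm S n) (u v : Fin n → Fin n → Fin 2),
    1 < n ∧ (∀ i, u i i ≠ v i i) ∧ TaylorOn S A t u v

/-- `A` and `B` lie in a common (locally finite, as they are finite) Taylor variety:
they share a common Taylor term with common Taylor identities. -/
def CommonTaylor (S : Signature) (A B : Type) [SAlg S A] [SAlg S B] : Prop :=
  ∃ (n : ℕ) (t : STerm S n) (u v : Fin n → Fin n → Fin 2),
    1 < n ∧ (∀ i, u i i ≠ v i i) ∧ TaylorOn S A t u v ∧ TaylorOn S B t u v

/-- The quotient of `A` by (the equivalence relation of) `θ`. -/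
abbrev ConQuot {A : Type} (θ : Set (A × A)) : Type :=
  Quot (fun a b => (a, b) ∈ θ)

/-- The class of `a` in `A/θ`. -/
def ConQuot.mk {A : Type} (θ : Set (A × A)) (a : A) : ConQuot θ :=
  Quot.mk _ a

/-- The quotient algebra structure on `A/θ` (extensionally correct when `θ` is a
congruence). -/
noncomputable def quotAlg {S : Signature} {A : Type} (iA : SAlg S A) (θ : Set (A × A)) :
    SAlg S (ConQuot θ) :=
  ⟨fun o x => ConQuot.mk θ
    (@SAlg.interp S A iA o fun i => Classical.choose (Quot.exists_rep (x i)))⟩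

/-- `f` is a homomorphism with respect to the given algebra structures. -/
def IsHomI {S : Signature} {A B : Type} (iA : SAlg S A) (iB : SAlg S B) (f : A → B) : Prop :=
  ∀ (o : S.ops) (x : Fin (S.arity o) → A),
    f (@SAlg.interp S A iA o x) = @SAlg.interp S B iB o fun i => f (x i)

/-- The two algebras are isomorphic. -/
def IsoAlgI {S : Signature} {A B : Type} (iA : SAlg S A) (iB : SAlg S B) : Prop :=
  ∃ f : A ≃ B, IsHomI iA iB f

/-- The identity bridge `I_{(A,ρ,L)}`. -/
def idBridge {A : Type} (ρ L : Set (A × A)) : Set (A × A × A × A) :=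
  {p | (p.1, p.2.1) ∈ L ∧ (p.2.2.1, p.2.2.2) ∈ L ∧ (p.1, p.2.2.1) ∈ ρ ∧ (p.2.1, p.2.2.2) ∈ ρ}

/-- Composition of quaternary relations (bridges). -/
def bComp {A B C : Type} (T : Set (A × A × B × B)) (T' : Set (B × B × C × C)) :
    Set (A × A × C × C) :=
  {p | ∃ b₁ b₂, (p.1, p.2.1, b₁, b₂) ∈ T ∧ (b₁, b₂, p.2.2.1, p.2.2.2) ∈ T'}

/-- Converse of a quaternary relation (bridge). -/
def bConv {A B : Type} (T : Set (A × A × B × B)) : Set (B × B × A × A) :=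
  {p | (p.2.2.1, p.2.2.2, p.1, p.2.1) ∈ T}

/-- `Δ♭_{θ,α}`: the congruence `Δ_{θ,α}` of `A(θ)` viewed as a quaternary relation. -/
def deltaFlat (S : Signature) {A : Type} [SAlg S A] (θ α : Set (A × A)) :
    Set (A × A × A × A) :=
  {p | ((p.1, p.2.1), (p.2.2.1, p.2.2.2)) ∈ DeltaCon S θ α}

/-- `T^opt_{(A,ρ)} = I_{(A,ρ,ρ⁺)} ∘ Δ♭_{ρ⁺,(ρ:ρ⁺)} ∘ I_{(A,ρ,ρ⁺)}`. -/
def Topt (S : Signature) {A : Type} [SAlg S A] (ρ ρplus : Set (A × A)) :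
    Set (A × A × A × A) :=
  bComp (idBridge ρ ρplus)
    (bComp (deltaFlat S ρplus (centralizer S ρ ρplus)) (idBridge ρ ρplus))

/-- `A` is subdirectly irreducible with monolith `μ`. -/
def IsMonolith (S : Signature) {A : Type} [SAlg S A] (μ : Set (A × A)) : Prop :=
  IsCongruence S μ ∧ μ ≠ diag A ∧ ∀ θ, IsCongruence S θ → θ ≠ diag A → μ ⊆ θ

/-- The carrier of `D(A,θ)`-style quotients: `A(μ)/Δ_{μ,α}`. -/
abbrev DCar (S : Signature) (A : Type) [SAlg S A] (μ α : Set (A × A)) : Type :=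
  Quot (fun p q : ↥μ => ((p : A × A), (q : A × A)) ∈ DeltaCon S μ α)

/-- The class of a pair `p ∈ μ` in `A(μ)/Δ_{μ,α}`. -/
def DCar.mk (S : Signature) (A : Type) [SAlg S A] (μ α : Set (A × A)) (p : ↥μ) :
    DCar S A μ α :=
  Quot.mk _ p

/-- The algebra structure on `A(μ)/Δ_{μ,α}` (extensionally correct when `μ` is a
congruence and `Δ_{μ,α}` is a congruence of `A(μ)`). -/
noncomputable def DAlg (S : Signature) (A : Type) [SAlg S A] (μ α : Set (A × A))
    (h : IsSubuniverse S μ) : SAlg S (DCar S A μ α) :=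
  letI := subAlg μ h
  ⟨fun o x => DCar.mk S A μ α
    (SAlg.interp o fun i => Classical.choose (Quot.exists_rep (x i)))⟩

/-- The canonical similarity bridge `T_{D(A)}` from `A` to `D(A)`. -/
def TDBridge (S : Signature) (A : Type) [SAlg S A] (μ α : Set (A × A)) :
    Set (A × A × DCar S A μ α × DCar S A μ α) :=
  {x | ∃ (a b e : A) (_ : (a, b) ∈ μ) (h1 : (a, e) ∈ μ) (h2 : (b, e) ∈ μ),
    x = (a, b, DCar.mk S A μ α ⟨(a, e), h1⟩, DCar.mk S A μ α ⟨(b, e), h2⟩)}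

/-- Similarity of (subdirectly irreducible) algebras: `D(A) ≅ D(B)`, where `D(X)` is
`X(μ)/Δ_{μ,(0:μ)}` if the monolith `μ` is abelian, and `X` itself otherwise. -/
def SimilarI (S : Signature) {A B : Type} (iA : SAlg S A) (iB : SAlg S B) : Prop :=
  letI := iA
  letI := iB
  ∃ (μA : Set (A × A)) (μB : Set (B × B)) (hA : IsMonolith S μA) (hB : IsMonolith S μB),
    ((Centralizes S μA μA (diag A) ∧ Centralizes S μB μB (diag B)) →
      IsoAlgI (DAlg S A μA (centralizer S (diag A) μA) hA.1.1)
        (DAlg S B μB (centralizer S (diag B) μB) hB.1.1)) ∧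
    ((Centralizes S μA μA (diag A) ∧ ¬ Centralizes S μB μB (diag B)) →
      IsoAlgI (DAlg S A μA (centralizer S (diag A) μA) hA.1.1) iB) ∧
    ((¬ Centralizes S μA μA (diag A) ∧ Centralizes S μB μB (diag B)) →
      IsoAlgI iA (DAlg S B μB (centralizer S (diag B) μB) hB.1.1)) ∧
    ((¬ Centralizes S μA μA (diag A) ∧ ¬ Centralizes S μB μB (diag B)) →
      IsoAlgI iA iB)

end Zhuk

namespace Zhuk

theorem iterate_mem_of_comp_mem {Y : Type*} {W : Set (Y → Y)} (hid : id ∈ W)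
    (hcomp : ∀ f ∈ W, ∀ g ∈ W, f ∘ g ∈ W) {f : Y → Y} (hf : f ∈ W) (k : ℕ) : f^[k] ∈ W := by
  induction k with
  | zero => exact hid
  | succ k ih => exact hcomp _ ih _ hf

section Trace

variable {Y : Type*} [Finite Y]

theorem exists_iterate_idempotent (f : Y → Y) :
    ∃ m, 0 < m ∧ ∀ x, f^[m] (f^[m] x) = f^[m] x := by
  obtain ⟨i, j, hij, h⟩ := Finite.exists_ne_map_eq_of_infinite fun k : ℕ => f^[k]
  wlog hlt : i < j generalizing i j
  · exact this j i hij.symm h.symm (by omega)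
  obtain ⟨p, rfl⟩ : ∃ p, j = i + p := ⟨j - i, by omega⟩
  have hper : ∀ k, f^[i + k + p] = f^[i + k] := by
    intro k
    rw [show i + k + p = k + (i + p) by omega, Function.iterate_add, ← h,
      ← Function.iterate_add, add_comm]
  have hmul : ∀ c k, f^[i + k + p * c] = f^[i + k] := by
    intro c
    induction c with
    | zero => simp
    | succ c ih =>
      intro k
      rw [show i + k + p * (c + 1) = i + (k + p * c) + p by ring, hper, ← ih k]
      congr 1
      omega
  refine ⟨p * (i + 1), Nat.mul_pos (by omega) (by omega), fun x => ?_⟩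
  have hle : i ≤ p * (i + 1) := by nlinarith
  obtain ⟨k, hk⟩ : ∃ k, p * (i + 1) = i + k := ⟨p * (i + 1) - i, by omega⟩
  rw [← Function.iterate_add_apply]
  have := congrFun (hmul (i + 1) k) x
  rwa [← hk] at this

/-- A monoid of self-maps of `B` fixing `z` contains a nonzero idempotent `e` and a nonzero point
of its image which is killed by every map into the image that does not permute the image. -/
theorem exists_trace {B : Set Y} {z : Y} (hB : ∃ a ∈ B, a ≠ z) {W : Set (Y → Y)}
    (hid : id ∈ W) (hcomp : ∀ f ∈ W, ∀ g ∈ W, f ∘ g ∈ W) (hmaps : ∀ f ∈ W, Set.MapsTo f B B) :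
    ∃ e ∈ W, (∀ x ∈ B, e (e x) = e x) ∧ ∃ a ∈ B, e a = a ∧ a ≠ z ∧
      ∀ f ∈ W, Set.InjOn (e ∘ f) (e '' B) ∨ e (f a) = z := by
  obtain ⟨e, ⟨heW, hee, a₀, ha₀, hea₀⟩, hmin⟩ := exists_minimalFor_of_wellFoundedLT
    (fun e : Y → Y => e ∈ W ∧ (∀ x ∈ B, e (e x) = e x) ∧ ∃ a ∈ B, e a ≠ z)
    (fun e => (e '' B).ncard) ⟨id, hid, fun _ _ => rfl, hB⟩
  refine ⟨e, heW, hee, ?_⟩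
  by_contra! hcon
  choose! F hFW hFinj hFne using hcon
  have hstep : ∀ a, (a ∈ B ∧ e a = a ∧ a ≠ z) →
      (e (F a a) ∈ B ∧ e (e (F a a)) = e (F a a) ∧ e (F a a) ≠ z) := by
    rintro a ⟨h1, h2, h3⟩
    have hb : F a a ∈ B := hmaps _ (hFW a h1 h2 h3) h1
    exact ⟨hmaps _ heW hb, hee _ hb, hFne a h1 h2 h3⟩
  set s : Y → Y := fun a => e (F a a) with hs
  have hiter : ∀ k a, (a ∈ B ∧ e a = a ∧ a ≠ z) →
      (s^[k] a ∈ B ∧ e (s^[k] a) = s^[k] a ∧ s^[k] a ≠ z) := by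
    intro k
    induction k with
    | zero => exact fun a h => h
    | succ k ih => exact fun a h => ih _ (hstep a h)
  have hword : ∀ k a, (a ∈ B ∧ e a = a ∧ a ≠ z) →
      ∃ w ∈ W, w a = s^[k + 1] a ∧ (w '' (e '' B)).ncard < (e '' B).ncard := by
    intro k
    induction k with
    | zero =>
      rintro a ⟨h1, h2, h3⟩
      refine ⟨e ∘ F a, hcomp _ heW _ (hFW a h1 h2 h3), rfl, ?_⟩
      exact lt_of_le_of_ne (Set.ncard_image_le (Set.toFinite _))
        fun h => hFinj a h1 h2 h3 (Set.injOn_of_ncard_image_eq h (Set.toFinite _))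
    | succ k ih =>
      intro a ha
      obtain ⟨w, hwW, hwa, hw⟩ := ih a ha
      obtain ⟨h1, h2, h3⟩ := hiter (k + 1) a ha
      refine ⟨(e ∘ F (s^[k + 1] a)) ∘ w, hcomp _ (hcomp _ heW _ (hFW _ h1 h2 h3)) _ hwW, ?_, ?_⟩
      · rw [Function.iterate_succ_apply' s (k + 1)]
        simp [hwa, hs]
      · rw [Set.image_comp]
        exact (Set.ncard_image_le (Set.toFinite _)).trans_lt hw
  have ha₁ : e a₀ ∈ B ∧ e (e a₀) = e a₀ ∧ e a₀ ≠ z := ⟨hmaps _ heW ha₀, hee _ ha₀, hea₀⟩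
  obtain ⟨i, j, hij, h⟩ := Finite.exists_ne_map_eq_of_infinite fun k : ℕ => s^[k] (e a₀)
  wlog hlt : i < j generalizing i j
  · exact this j i hij.symm h.symm (by omega)
  obtain ⟨p, rfl⟩ : ∃ p, j = p + 1 + i := ⟨j - i - 1, by omega⟩
  obtain ⟨hx1, hx2, hx3⟩ := hiter i _ ha₁
  set x := s^[i] (e a₀) with hx
  have hper : s^[p + 1] x = x := by
    rw [hx, ← Function.iterate_add_apply]
    exact h.symm
  obtain ⟨w, hwW, hwx, hw⟩ := hword p x ⟨hx1, hx2, hx3⟩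
  obtain ⟨m, hm, hidem⟩ := exists_iterate_idempotent (w ∘ e)
  have hfix : (w ∘ e)^[m] x = x :=
    Function.iterate_fixed (by simp [hx2, hwx, hper]) m
  have hle := hmin (j := (w ∘ e)^[m]) ⟨iterate_mem_of_comp_mem hid hcomp (hcomp _ hwW _ heW) m,
    fun y _ => hidem y, x, hx1, by rwa [hfix]⟩
  have hsub : ((w ∘ e)^[m] '' B).ncard < (e '' B).ncard := by
    refine lt_of_le_of_lt (Set.ncard_le_ncard ?_ (Set.toFinite _)) hw
    obtain ⟨m, rfl⟩ : ∃ l, m = l + 1 := ⟨m - 1, by omega⟩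
    rintro _ ⟨y, hy, rfl⟩
    rw [Function.iterate_succ_apply']
    exact ⟨_, ⟨_, hmaps _ (iterate_mem_of_comp_mem hid hcomp (hcomp _ hwW _ heW) m) hy, rfl⟩, rfl⟩
  exact absurd (hle hsub.le) (not_le.mpr hsub)

end Trace

section Affine

variable {V : Type*} [AddCommGroup V] {n : ℕ}

/-- `D` is closed under the operation `∑ αᵢ xᵢ`, which on `D` is idempotent and satisfies, for
every coordinate `i`, a linear identity in which `i` occurs on exactly one side. -/
structure IsTaylorSum (α : Fin n → V →+ V) (U U' : Fin n → Finset (Fin n)) (D : Set V) :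
    Prop where
  mem : ∀ i, i ∈ U i
  notMem : ∀ i, i ∉ U' i
  zero_mem : 0 ∈ D
  sum_mem : ∀ d : Fin n → V, (∀ i, d i ∈ D) → ∑ i, α i (d i) ∈ D
  sum_eq : ∀ d ∈ D, ∑ i, α i d = d
  balanced : ∀ i, ∀ d ∈ D, ∑ j ∈ U i, α j d = ∑ j ∈ U' i, α j d

variable {α : Fin n → V →+ V} {U U' : Fin n → Finset (Fin n)} {D : Set V}

theorem IsTaylorSum.sum_two_mem (h : IsTaylorSum α U U' D) {i j : Fin n} (hij : i ≠ j) {x y : V}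
    (hx : x ∈ D) (hy : y ∈ D) : α i x + α j y ∈ D := by
  have := h.sum_mem (fun k => if k = i then x else if k = j then y else 0) fun k => by
    split_ifs
    exacts [hx, hy, h.zero_mem]
  convert this using 1
  rw [Fintype.sum_eq_add i j hij]
  · simp [hij.symm]
  · rintro k ⟨h1, h2⟩
    simp [h1, h2]

theorem IsTaylorSum.map_mem (h : IsTaylorSum α U U' D) (i : Fin n) {x : V} (hx : x ∈ D) :
    α i x ∈ D := by
  have := h.sum_mem (fun k => if k = i then x else 0) fun k => by
    split_ifs
    exacts [hx, h.zero_mem]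
  convert this using 1
  rw [Fintype.sum_eq_single i]
  · simp
  · intro k h1
    simp [h1]

/-- Every element of a subgroup contained in `D` is a value of `∑ αⱼ xⱼ` not using the `i`-th
coordinate. -/
theorem IsTaylorSum.exists_sum_eq (h : IsTaylorSum α U U' D) {E : AddSubgroup V}
    (hE : (E : Set V) ⊆ D) (i : Fin n) {w : V} (hw : w ∈ E) :
    ∃ d : Fin n → V, (∀ j, d j ∈ E) ∧ d i = 0 ∧ ∑ j, α j (d j) = w := by
  refine ⟨fun j => w + (if j ∈ U' i then w else 0) - (if j ∈ U i then w else 0), fun j => ?_,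
    ?_, ?_⟩
  · dsimp only
    refine E.sub_mem (E.add_mem hw ?_) ?_ <;> split_ifs <;> first | exact hw | exact E.zero_mem
  · simp [h.mem i, h.notMem i]
  · have hb := h.balanced i w (hE hw)
    simp only [map_add, map_sub, apply_ite (α _), map_zero, Finset.sum_add_distrib,
      Finset.sum_sub_distrib, Finset.sum_ite_mem, Finset.univ_inter, h.sum_eq w (hE hw), hb]
    abel

theorem addSubgroup_of_finite [Finite V] {E : Set V} (h0 : (0 : V) ∈ E)
    (hadd : ∀ x ∈ E, ∀ y ∈ E, x + y ∈ E) : ∃ F : AddSubgroup V, (F : Set V) = E := by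
  have hs : ∀ k : ℕ, ∀ x ∈ E, k • x ∈ E := by
    intro k x hx
    induction k with
    | zero => simpa using h0
    | succ k ih => rw [succ_nsmul]; exact hadd _ ih _ hx
  refine ⟨{ carrier := E, add_mem' := fun {a b} ha hb => hadd a ha b hb, zero_mem' := h0,
            neg_mem' := fun {x} hx => ?_ }, rfl⟩
  have h1 : (addOrderOf x - 1) • x + x = 0 := by
    rw [← succ_nsmul, Nat.sub_add_cancel (addOrderOf_pos x), addOrderOf_nsmul_eq_zero]
  rw [← eq_neg_of_add_eq_zero_left h1]
  exact hs _ x hx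

theorem IsTaylorSum.exists_addSubgroup [Finite V] (h : IsTaylorSum α U U' D)
    (hD : ∃ d ∈ D, d ≠ 0) : ∃ F : AddSubgroup V, F ≠ ⊥ ∧ (F : Set V) ⊆ D := by
  obtain ⟨e, ⟨⟨e, rfl⟩, heD⟩, hee, a, haD, hea, ha0, hkill⟩ :=
    exists_trace (B := D) (z := 0) hD
      (W := {f | (∃ g : V →+ V, ⇑g = f) ∧ Set.MapsTo f D D})
      ⟨⟨AddMonoidHom.id V, rfl⟩, Set.mapsTo_id D⟩
      (by
        rintro _ ⟨⟨f, rfl⟩, hf⟩ _ ⟨⟨g, rfl⟩, hg⟩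
        exact ⟨⟨f.comp g, rfl⟩, hf.comp hg⟩)
      (fun f hf => hf.2)
  have hW : ∀ i, Set.InjOn (e ∘ α i) (e '' D) ∨ e (α i a) = 0 := fun i =>
    hkill _ ⟨⟨α i, rfl⟩, fun x hx => h.map_mem i hx⟩
  have hsep : ∀ i₀, ∃ j, j ≠ i₀ ∧ e (α j a) ≠ 0 := by
    intro i₀
    by_contra! hall
    have hb := congrArg e (h.balanced i₀ a haD)
    rw [map_sum, map_sum, Finset.sum_eq_single_of_mem i₀ (h.mem i₀) fun j _ hj => hall j hj,
      Finset.sum_eq_zero fun j hj => hall j fun hji => h.notMem i₀ (by rwa [hji] at hj)] at hb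
    have hs := congrArg e (h.sum_eq a haD)
    rw [map_sum, Finset.sum_eq_zero, hea] at hs
    · exact ha0 hs.symm
    · intro j _
      by_cases hj : j = i₀
      · rw [hj, hb]
      · exact hall j hj
  have hex : ∃ i : Fin n, e (α i a) ≠ 0 := by
    by_contra! hall
    have hs := congrArg e (h.sum_eq a haD)
    rw [map_sum, Finset.sum_eq_zero fun j _ => hall j, hea] at hs
    exact ha0 hs.symm
  obtain ⟨i, hi⟩ := hex
  obtain ⟨j, hji, hj⟩ := hsep i
  have hsurj : ∀ k, e (α k a) ≠ 0 → ∀ x ∈ e '' D, ∃ y ∈ e '' D, e (α k y) = x := by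
    intro k hk x hx
    have hmaps : Set.MapsTo (e ∘ α k) (e '' D) (e '' D) := by
      rintro _ ⟨y, hy, rfl⟩
      exact ⟨_, h.map_mem k (heD hy), rfl⟩
    exact (((Set.toFinite _).injOn_iff_bijOn_of_mapsTo hmaps).1 ((hW k).resolve_right hk)).surjOn hx
  obtain ⟨F, hF⟩ := addSubgroup_of_finite (E := e '' D) ⟨0, h.zero_mem, map_zero e⟩ (by
    intro x hx y hy
    obtain ⟨_, ⟨x', hx', rfl⟩, rfl⟩ := hsurj i hi x hx
    obtain ⟨_, ⟨y', hy', rfl⟩, rfl⟩ := hsurj j hj y hy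
    rw [← map_add]
    exact ⟨_, h.sum_two_mem hji.symm (heD hx') (heD hy'), rfl⟩)
  refine ⟨F, fun hbot => ha0 ?_, ?_⟩
  · have : a ∈ F := by
      rw [← SetLike.mem_coe, hF]
      exact ⟨a, haD, hea⟩
    simpa [hbot] using this
  · rw [hF]
    rintro _ ⟨x, hx, rfl⟩
    exact heD hx

theorem IsTaylorSum.eq_addSubgroup [Finite V] (h : IsTaylorSum α U U' D) :
    ∃ F : AddSubgroup V, (F : Set V) = D := by
  obtain ⟨E, hE, hmax⟩ := (Set.toFinite {F : AddSubgroup V | (F : Set V) ⊆ D}).exists_maximal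
    ⟨⊥, by simpa using h.zero_mem⟩
  replace hmax : ∀ F : AddSubgroup V, (F : Set V) ⊆ D → E ≤ F → F ≤ E := fun F h1 h2 => hmax h1 h2
  refine ⟨E, subset_antisymm hE ?_⟩
  have hstab : ∀ i, E ≤ E.comap (α i) := by
    let g : (Fin n → E) →+ V :=
      { toFun := fun d => ∑ i, α i (d i)
        map_zero' := by simp
        map_add' := fun x y => by simp [Finset.sum_add_distrib] }
    have hg : g.range ≤ E := by
      apply hmax
      · rintro _ ⟨d, rfl⟩
        exact h.sum_mem _ fun i => hE (d i).2
      · exact fun x hx => ⟨fun _ => ⟨x, hx⟩, h.sum_eq x (hE hx)⟩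
    intro i x hx
    refine hg ⟨fun k => if k = i then ⟨x, hx⟩ else 0, ?_⟩
    change ∑ k, α k ((if k = i then (⟨x, hx⟩ : E) else 0 : E) : V) = α i x
    rw [Fintype.sum_eq_single i]
    · simp
    · intro k hk
      simp [hk]
  by_contra hnot
  obtain ⟨d₀, hd₀, hd₀E⟩ := Set.not_subset.1 hnot
  have hq : IsTaylorSum (fun i => QuotientAddGroup.map E E (α i) (hstab i)) U U'
      ((fun x : V => (x : V ⧸ E)) '' D) :=
    { mem := h.mem
      notMem := h.notMem
      zero_mem := ⟨0, h.zero_mem, rfl⟩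
      sum_mem := by
        intro d hd
        choose d' hd' hdd' using hd
        refine ⟨_, h.sum_mem d' hd', ?_⟩
        simp only [← hdd']
        exact map_sum (QuotientAddGroup.mk' E) _ _
      sum_eq := by
        rintro _ ⟨d, hd, rfl⟩
        refine Eq.trans ?_ (congrArg (QuotientAddGroup.mk' E) (h.sum_eq d hd))
        exact (map_sum (QuotientAddGroup.mk' E) _ _).symm
      balanced := by
        rintro i _ ⟨d, hd, rfl⟩
        have := congrArg (QuotientAddGroup.mk' E) (h.balanced i d hd)
        rw [map_sum, map_sum] at this
        exact this }
  obtain ⟨F', hF', hF'D⟩ := hq.exists_addSubgroup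
    ⟨_, ⟨d₀, hd₀, rfl⟩, fun h0 => hd₀E ((QuotientAddGroup.eq_zero_iff d₀).1 h0)⟩
  have hdecomp : ∀ x : V, (x : V ⧸ E) ∈ F' → ∃ d ∈ D, ∃ w ∈ E, x = d + w ∧ (d : V ⧸ E) ∈ F' := by
    intro x hx
    obtain ⟨d, hd, hdx⟩ := hF'D hx
    refine ⟨d, hd, -d + x, QuotientAddGroup.eq.1 hdx, by abel, ?_⟩
    have : (d : V ⧸ E) = x := hdx
    rwa [this]
  have hkill : ∀ i, ∀ x : V, (x : V ⧸ E) ∈ F' → α i x ∈ E := by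
    intro i
    have hle : (F'.comap (QuotientAddGroup.mk' E)).map (α i) ⊔ E ≤ E := by
      apply hmax _ _ le_sup_right
      intro y hy
      obtain ⟨_, ⟨x, hx, rfl⟩, w', hw', rfl⟩ := AddSubgroup.mem_sup.1 hy
      obtain ⟨d, hd, w, hw, rfl, -⟩ := hdecomp x hx
      obtain ⟨c, hcE, hci, hc⟩ := h.exists_sum_eq hE i (E.add_mem (hstab i hw) hw')
      have := h.sum_mem (Function.update c i d) fun j => by
        by_cases hj : j = i
        · subst hj; simpa using hd
        · simpa [hj] using hE (hcE j)
      convert this using 1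
      rw [map_add, add_assoc]
      change α i d + (α i w + w') = _
      rw [← hc, Fintype.sum_eq_add_sum_compl i, Fintype.sum_eq_add_sum_compl i, hci]
      simp only [map_zero, zero_add, Function.update_self]
      congr 1
      refine Finset.sum_congr rfl fun j hj => ?_
      rw [Function.update_of_ne (by simpa using hj)]
    exact fun x hx => hle (AddSubgroup.mem_sup_left ⟨x, hx, rfl⟩)
  apply hF'
  rw [eq_bot_iff]
  intro q hq'
  obtain ⟨x, rfl⟩ := QuotientAddGroup.mk_surjective q
  obtain ⟨d, hd, w, hw, rfl, hdF⟩ := hdecomp x hq'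
  have hdE : d ∈ E := by
    rw [← h.sum_eq d hd]
    exact E.sum_mem fun i _ => hkill i d hdF
  exact (QuotientAddGroup.eq_zero_iff _).2 (E.add_mem hdE hw)

end Affine

section Polynomials

variable {S : Signature} {X : Type} [SAlg S X]

/-- The functions `Y → X` obtained from constants and the functions in `V` by applying basic
operations pointwise. -/
inductive PolyFun (S : Signature) {X : Type} [SAlg S X] {Y : Type*} (V : Set (Y → X)) :
    (Y → X) → Prop
  | var {f : Y → X} (hf : f ∈ V) : PolyFun S V f
  | const (c : X) : PolyFun S V fun _ => c
  | app (o : S.ops) (f : Fin (S.arity o) → Y → X) (hf : ∀ i, PolyFun S V (f i)) :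
      PolyFun S V fun y => SAlg.interp o fun i => f i y

theorem PolyFun.comp {Y Z : Type*} {V : Set (Y → X)} {W : Set (Z → X)} {f : Y → X} {u : Z → Y}
    (hf : PolyFun S V f) (h : ∀ v ∈ V, PolyFun S W (v ∘ u)) : PolyFun S W (f ∘ u) := by
  induction hf with
  | var hf => exact h _ hf
  | const c => exact .const c
  | app o f _ ih => exact .app o (fun i => f i ∘ u) ih

/-- The unary polynomial operations. -/
abbrev IsPoly₁ (S : Signature) {X : Type} [SAlg S X] (f : X → X) : Prop :=
  PolyFun S {id} f

/-- The binary polynomial operations. -/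
abbrev IsPoly₂ (S : Signature) {X : Type} [SAlg S X] (f : X → X → X) : Prop :=
  PolyFun S {Prod.fst, Prod.snd} fun p : X × X => f p.1 p.2

theorem IsPoly₁.id : IsPoly₁ S (id : X → X) := .var rfl

theorem IsPoly₁.comp {Y : Type*} {V : Set (Y → X)} {f : X → X} {g : Y → X} (hf : IsPoly₁ S f)
    (hg : PolyFun S V g) : PolyFun S V (f ∘ g) :=
  PolyFun.comp hf fun v hv => by
    rw [Set.mem_singleton_iff.1 hv]
    exact hg

theorem IsPoly₂.comp {Y : Type*} {V : Set (Y → X)} {f : X → X → X} {g h : Y → X}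
    (hf : IsPoly₂ S f) (hg : PolyFun S V g) (hh : PolyFun S V h) :
    PolyFun S V fun y => f (g y) (h y) :=
  PolyFun.comp (u := fun y => (g y, h y)) hf fun v hv => by
    rcases hv with rfl | rfl
    exacts [hg, hh]

theorem IsPoly₁.iterate {f : X → X} (hf : IsPoly₁ S f) (k : ℕ) : IsPoly₁ S f^[k] := by
  induction k with
  | zero => exact IsPoly₁.id
  | succ k ih => exact IsPoly₁.comp ih hf

/-- Evaluation of a term is polynomial in its variables. -/
theorem STerm.polyFun {n : ℕ} (t : STerm S n) :
    PolyFun S (Set.range fun (i : Fin n) (w : Fin n → X) => w i) fun w => t.eval w := by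
  induction t with
  | var i => exact .var ⟨i, rfl⟩
  | app o ts ih => exact .app o _ ih

theorem polyFun_update {n : ℕ} {f : (Fin n → X) → X}
    (hf : PolyFun S (Set.range fun (i : Fin n) (w : Fin n → X) => w i) f) (w : Fin n → X)
    (i : Fin n) : IsPoly₁ S fun x => f (Function.update w i x) :=
  PolyFun.comp (u := fun x => Function.update w i x) hf fun v hv => by
    obtain ⟨j, rfl⟩ := hv
    by_cases h : j = i
    · subst h
      have : (fun w : Fin n → X => w j) ∘ (fun x => Function.update w j x) = id := by
        funext x
        simp
      rw [this]
      exact IsPoly₁.id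
    · have : (fun w : Fin n → X => w j) ∘ (fun x => Function.update w i x) = fun _ => w j := by
        funext x
        simp [h]
      rw [this]
      exact .const _

theorem IsSubuniverse.polyFun {R : Set (X × X)} (hR : IsSubuniverse S R)
    (hrefl : ∀ x, (x, x) ∈ R) {Y : Type*} {V : Set (Y → X)} {f : Y → X} (hf : PolyFun S V f)
    {y z : Y} (h : ∀ v ∈ V, (v y, v z) ∈ R) : (f y, f z) ∈ R := by
  induction hf with
  | var hf => exact h _ hf
  | const c => exact hrefl c
  | app o f _ ih => exact hR o (fun i => (f i y, f i z)) ih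

theorem IsSubuniverse.poly₁ {R : Set (X × X)} (hR : IsSubuniverse S R)
    (hrefl : ∀ x, (x, x) ∈ R) {f : X → X} (hf : IsPoly₁ S f) {x y : X} (h : (x, y) ∈ R) :
    (f x, f y) ∈ R :=
  hR.polyFun hrefl hf fun v hv => by rwa [Set.mem_singleton_iff.1 hv]

/-- An equivalence relation preserved by all unary polynomials is compatible with all basic
operations. -/
theorem isSubuniverse_of_poly₁ {R : Set (X × X)} (hrefl : ∀ x, (x, x) ∈ R)
    (htrans : ∀ x y z, (x, y) ∈ R → (y, z) ∈ R → (x, z) ∈ R)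
    (h : ∀ f, IsPoly₁ S f → ∀ x y, (x, y) ∈ R → (f x, f y) ∈ R) : IsSubuniverse S R := by
  intro o x hx
  have key : ∀ s : Finset (Fin (S.arity o)),
      (SAlg.interp o fun i => (x i).1,
        SAlg.interp o (s.piecewise (fun i => (x i).2) fun i => (x i).1)) ∈ R := by
    intro s
    induction s using Finset.induction_on with
    | empty => simpa using hrefl _
    | insert i s hi ih =>
      refine htrans _ _ _ ih ?_
      have hp := polyFun_update (S := S)
        (f := fun w => SAlg.interp o w) (.app o _ fun j => .var ⟨j, rfl⟩)
        (s.piecewise (fun i => (x i).2) fun i => (x i).1) i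
      have := h _ hp _ _ (hx i)
      rwa [← Finset.piecewise_insert, Function.update_eq_self_iff.2 (by simp [hi])] at this
  have := key Finset.univ
  rwa [Finset.piecewise_univ] at this

end Polynomials

section Matrices

variable {S : Signature} {X : Type} [SAlg S X]

/-- The subuniverse of `X⁴` generated by `(a, b, c, d)` and all `(x, y, x, y)` with
`(x, y) ∈ θ`. -/
inductive TCMatrix (S : Signature) {X : Type} [SAlg S X] (θ : Set (X × X)) (a b c d : X) :
    X → X → X → X → Prop
  | base : TCMatrix S θ a b c d a b c d
  | par {x y : X} (h : (x, y) ∈ θ) : TCMatrix S θ a b c d x y x y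
  | app (o : S.ops) (p q r s : Fin (S.arity o) → X)
      (h : ∀ i, TCMatrix S θ a b c d (p i) (q i) (r i) (s i)) :
      TCMatrix S θ a b c d (SAlg.interp o p) (SAlg.interp o q) (SAlg.interp o r)
        (SAlg.interp o s)

variable {θ : Set (X × X)} {a b c d : X}

theorem TCMatrix.polyFun (hrefl : ∀ x, (x, x) ∈ θ) {Y : Type*} {V : Set (Y → X)} {f : Y → X}
    (hf : PolyFun S V f) {y₁ y₂ y₃ y₄ : Y}
    (h : ∀ v ∈ V, TCMatrix S θ a b c d (v y₁) (v y₂) (v y₃) (v y₄)) :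
    TCMatrix S θ a b c d (f y₁) (f y₂) (f y₃) (f y₄) := by
  induction hf with
  | var hf => exact h _ hf
  | const c => exact .par (hrefl c)
  | app o f _ ih => exact .app o _ _ _ _ ih

theorem TCMatrix.poly₁ (hrefl : ∀ x, (x, x) ∈ θ) {f : X → X} (hf : IsPoly₁ S f) {p q r s : X}
    (h : TCMatrix S θ a b c d p q r s) : TCMatrix S θ a b c d (f p) (f q) (f r) (f s) :=
  TCMatrix.polyFun hrefl hf fun v hv => by rwa [Set.mem_singleton_iff.1 hv]

theorem TCMatrix.poly₂ (hrefl : ∀ x, (x, x) ∈ θ) {f : X → X → X} (hf : IsPoly₂ S f)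
    {p q r s p' q' r' s' : X} (h : TCMatrix S θ a b c d p q r s)
    (h' : TCMatrix S θ a b c d p' q' r' s') :
    TCMatrix S θ a b c d (f p p') (f q q') (f r r') (f s s') :=
  TCMatrix.polyFun (y₁ := (p, p')) (y₂ := (q, q')) (y₃ := (r, r')) (y₄ := (s, s')) hrefl hf
    fun v hv => by
      rcases hv with rfl | rfl
      exacts [h, h']

end Matrices

section Trace

variable {S : Signature} {X : Type} [SAlg S X]

/-- `μ` is an abelian congruence, and `t` is a Taylor term. -/
structure IsAbelianTaylor (S : Signature) {X : Type} [SAlg S X] {n : ℕ} (t : STerm S n)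
    (u v : Fin n → Fin n → Fin 2) (μ : Set (X × X)) : Prop where
  cong : IsCongruence S μ
  ne : ∀ i, u i i ≠ v i i
  taylor : TaylorOn S X t u v
  abelian : ∀ a b p q r s, (a, b) ∈ μ → TCMatrix S μ a a b b p q r s → p = q → r = s

variable {n : ℕ} {t : STerm S n} {u v : Fin n → Fin n → Fin 2} {μ : Set (X × X)}

theorem IsAbelianTaylor.refl (h : IsAbelianTaylor S t u v μ) (x : X) : (x, x) ∈ μ :=
  h.cong.2.refl x

/-- Whether a polynomial separates two elements in the `j`-th coordinate does not depend on the
other coordinates. -/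
theorem IsAbelianTaylor.update_eq (h : IsAbelianTaylor S t u v μ) {f : (Fin n → X) → X}
    (hf : PolyFun S (Set.range fun (i : Fin n) (w : Fin n → X) => w i) f) {w w' : Fin n → X}
    (hw : ∀ i, (w i, w' i) ∈ μ) {x y : X} (hxy : (x, y) ∈ μ) (j : Fin n)
    (heq : f (Function.update w j x) = f (Function.update w j y)) :
    f (Function.update w' j x) = f (Function.update w' j y) := by
  have key : ∀ s : Finset (Fin n), f (Function.update (s.piecewise w' w) j x) =
      f (Function.update (s.piecewise w' w) j y) := by
    intro s
    induction s using Finset.induction_on with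
    | empty => simpa using heq
    | insert k s hk ih =>
      refine h.abelian _ _ _ _ _ _ (hw k) (TCMatrix.polyFun h.refl hf ?_) ih
      rintro _ ⟨i, rfl⟩
      dsimp only
      by_cases hij : i = j
      · subst hij
        simpa using .par hxy
      · rw [Function.update_of_ne hij, Function.update_of_ne hij, Function.update_of_ne hij,
          Function.update_of_ne hij]
        by_cases hik : i = k
        · subst hik
          simpa [hk] using TCMatrix.base
        · by_cases his : i ∈ s
          · simpa [his] using .par (h.refl _)
          · simpa [his, hik] using .par (h.refl _)
  simpa using key Finset.univ

/-- A subset of a `μ`-class on which a polynomial operation `add` is a group operation with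
neutral element `b`. -/
structure IsPolyGroup (S : Signature) {X : Type} [SAlg S X] (μ : Set (X × X)) (N : Set X)
    (b : X) (add : X → X → X) : Prop where
  poly : IsPoly₂ S add
  sub : ∀ x ∈ N, (b, x) ∈ μ
  zero_mem : b ∈ N
  add_mem : ∀ x ∈ N, ∀ y ∈ N, add x y ∈ N
  zero_add : ∀ x ∈ N, add b x = x
  add_zero : ∀ x ∈ N, add x b = x

theorem IsAbelianTaylor.add_comm (h : IsAbelianTaylor S t u v μ) {N : Set X} {b : X}
    {add : X → X → X} (hN : IsPolyGroup S μ N b add) {x y : X} (hx : x ∈ N) (hy : y ∈ N) :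
    add x y = add y x := by
  have hb := hN.zero_mem
  have hM : TCMatrix S μ b b x x (add (add y b) (add b b)) (add (add b b) (add y b))
      (add (add y x) (add b b)) (add (add b x) (add y b)) := by
    refine .poly₂ h.refl hN.poly (.poly₂ h.refl hN.poly (.par ?_) .base)
      (.poly₂ h.refl hN.poly (.par ?_) (.par (h.refl b)))
    exacts [h.cong.2.symm (hN.sub y hy), hN.sub y hy]
  have := h.abelian _ _ _ _ _ _ (hN.sub x hx) hM
    (by simp [hN.add_zero, hN.zero_add, hy, hb])
  simpa [hN.add_zero, hN.zero_add, hy, hb, hx, hN.add_mem y hy x hx, eq_comm] using this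

theorem IsAbelianTaylor.add_assoc (h : IsAbelianTaylor S t u v μ) {N : Set X} {b : X}
    {add : X → X → X} (hN : IsPolyGroup S μ N b add) {x y z : X} (hx : x ∈ N) (hy : y ∈ N)
    (hz : z ∈ N) : add (add x y) z = add x (add y z) := by
  have hb := hN.zero_mem
  have hM : TCMatrix S μ b b x x (add (add (add b y) z) (add (add b b) b))
      (add (add (add b b) b) (add (add b y) z))
      (add (add (add x y) z) (add (add b b) b)) (add (add (add x b) b) (add (add b y) z)) := by
    have hyb := h.cong.2.symm (hN.sub y hy)
    have hzb := h.cong.2.symm (hN.sub z hz)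
    refine .poly₂ h.refl hN.poly
      (.poly₂ h.refl hN.poly (.poly₂ h.refl hN.poly .base (.par hyb)) (.par hzb))
      (.poly₂ h.refl hN.poly (.poly₂ h.refl hN.poly (.par (h.refl b)) (.par (hN.sub y hy)))
        (.par (hN.sub z hz)))
  have := h.abelian _ _ _ _ _ _ (hN.sub x hx) hM
    (by simp [hN.add_zero, hN.zero_add, hy, hb, hN.add_mem y hy z hz])
  simpa [hN.add_zero, hN.zero_add, hy, hb, hx,
    hN.add_mem _ (hN.add_mem x hx y hy) z hz] using this

theorem IsAbelianTaylor.add_right_cancel (h : IsAbelianTaylor S t u v μ) {N : Set X} {b : X}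
    {add : X → X → X} (hN : IsPolyGroup S μ N b add) {x y z : X} (hx : x ∈ N) (hy : y ∈ N)
    (hz : z ∈ N) (heq : add x z = add y z) : x = y := by
  have hM : TCMatrix S μ z z b b (add x z) (add y z) (add x b) (add y b) :=
    .poly₂ h.refl hN.poly
      (.par (h.cong.2.trans (h.cong.2.symm (hN.sub x hx)) (hN.sub y hy))) .base
  have := h.abelian _ _ _ _ _ _ (h.cong.2.symm (hN.sub z hz)) hM heq
  rwa [hN.add_zero x hx, hN.add_zero y hy] at this

theorem IsAbelianTaylor.exists_neg [Finite X] (h : IsAbelianTaylor S t u v μ) {N : Set X} {b : X}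
    {add : X → X → X} (hN : IsPolyGroup S μ N b add) {x : X} (hx : x ∈ N) :
    ∃ y ∈ N, add y x = b := by
  have hinj : Set.InjOn (fun y => add y x) N := fun y hy z hz => h.add_right_cancel hN hy hz hx
  exact (((Set.toFinite N).injOn_iff_bijOn_of_mapsTo fun y hy => hN.add_mem y hy x hx).1
    hinj).surjOn hN.zero_mem

/-- The abelian group structure on a polynomially definable group. -/
noncomputable abbrev IsAbelianTaylor.addCommGroup [Finite X] (h : IsAbelianTaylor S t u v μ)
    {N : Set X} {b : X} {add : X → X → X} (hN : IsPolyGroup S μ N b add) : AddCommGroup N :=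
  letI : Add N := ⟨fun x y => ⟨add x y, hN.add_mem x x.2 y y.2⟩⟩
  letI : Zero N := ⟨⟨b, hN.zero_mem⟩⟩
  letI : Neg N := ⟨fun x => ⟨_, (h.exists_neg hN x.2).choose_spec.1⟩⟩
  { add_assoc := fun x y z => Subtype.ext (h.add_assoc hN x.2 y.2 z.2)
    zero_add := fun x => Subtype.ext (hN.zero_add x x.2)
    add_zero := fun x => Subtype.ext (hN.add_zero x x.2)
    add_comm := fun x y => Subtype.ext (h.add_comm hN x.2 y.2)
    neg_add_cancel := fun x => Subtype.ext (h.exists_neg hN x.2).choose_spec.2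
    nsmul := nsmulRec
    zsmul := zsmulRec }

theorem IsAbelianTaylor.mem_class_of_eval (h : IsAbelianTaylor S t u v μ) {b : X} {w : Fin n → X}
    (hw : ∀ i, (b, w i) ∈ μ) : (b, t.eval w) ∈ μ := by
  have := h.cong.1.polyFun h.refl t.polyFun (y := fun _ => b) (z := w) (by
    rintro _ ⟨i, rfl⟩
    exact hw i)
  rwa [h.taylor.1] at this

/-- Two coordinates of a Taylor term separate a given pair of points under any polynomial
retraction. -/
theorem IsAbelianTaylor.exists_two_coordinates (h : IsAbelianTaylor S t u v μ) {e : X → X}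
    (he : IsPoly₁ S e) {a b : X} (hab : (b, a) ∈ μ) (hne : a ≠ b) (hea : e a = a) (heb : e b = b)
    (i₀ : Fin n) : ∃ j, j ≠ i₀ ∧ e (t.eval (Function.update (fun _ => b) j a)) ≠ b := by
  by_contra! hall
  have hpoly := IsPoly₁.comp he t.polyFun
  have hstep : ∀ j, j ≠ i₀ → ∀ w : Fin n → X, (∀ i, w i = a ∨ w i = b) → ∀ x, (x = a ∨ x = b) →
      e (t.eval (Function.update w j x)) = e (t.eval (Function.update w j b)) := by
    rintro j hj w hw x (rfl | rfl)
    · refine h.update_eq hpoly (w := fun _ => b) (fun i => ?_) (h.cong.2.symm hab) j ?_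
      · rcases hw i with hi | hi <;> rw [hi]
        exacts [hab, h.refl _]
      · simp only [Function.comp_apply]
        rw [hall j hj, Function.update_eq_self, h.taylor.1, heb]
    · rfl
  have hdep : ∀ w : Fin n → X, (∀ i, w i = a ∨ w i = b) → e (t.eval w) = w i₀ := by
    intro w hw
    have key : ∀ s : Finset (Fin n),
        e (t.eval (s.piecewise (fun _ => w i₀) w)) = e (t.eval w) := by
      intro s
      induction s using Finset.induction_on with
      | empty => simp
      | insert k s hk ih =>
        rw [← ih, Finset.piecewise_insert]
        by_cases hki : k = i₀
        · subst hki
          rw [Function.update_eq_self_iff.2 (by simp [hk])]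
        · have hw' : ∀ i, s.piecewise (fun _ => w i₀) w i = a ∨
              s.piecewise (fun _ => w i₀) w i = b := by
            intro i
            by_cases hi : i ∈ s <;> simp [hi, hw]
          rw [hstep k hki _ hw' _ (hw i₀), ← hstep k hki _ hw' _ (hw' k),
            Function.update_eq_self]
    have := key Finset.univ
    rw [Finset.piecewise_univ, h.taylor.1] at this
    rw [← this]
    rcases hw i₀ with hi | hi <;> rw [hi] <;> assumption
  have h1 := congrArg e (h.taylor.2 i₀ a b)
  rw [hdep _ fun i => by split_ifs <;> simp, hdep _ fun i => by split_ifs <;> simp] at h1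
  have hu := h.ne i₀
  split_ifs at h1 with h2 h3 h3
  · exact hu (h2.trans h3.symm)
  · exact hne h1
  · exact hne h1.symm
  · omega

/-- Every nontrivial class of an abelian congruence retracts polynomially onto a nontrivial
polynomially definable group. -/
theorem IsAbelianTaylor.exists_polyGroup [Finite X] (h : IsAbelianTaylor S t u v μ) {b : X}
    (hB : ∃ a, (b, a) ∈ μ ∧ a ≠ b) :
    ∃ (N : Set X) (e : X → X) (add : X → X → X), IsPolyGroup S μ N b add ∧ IsPoly₁ S e ∧
      (∀ x, (b, x) ∈ μ → e x ∈ N) ∧ (∀ x ∈ N, e x = x) ∧ ∃ a ∈ N, a ≠ b := by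
  obtain ⟨e, ⟨he, heB, heb⟩, hee, a, haB, hea, hab, hkill⟩ :=
    exists_trace (B := {x | (b, x) ∈ μ}) (z := b) hB
      (W := {f | IsPoly₁ S f ∧ Set.MapsTo f {x | (b, x) ∈ μ} {x | (b, x) ∈ μ} ∧ f b = b})
      ⟨IsPoly₁.id, Set.mapsTo_id _, rfl⟩
      (fun f hf g hg => ⟨hf.1.comp hg.1, hf.2.1.comp hg.2.1, by simp [hf.2.2, hg.2.2]⟩)
      (fun f hf => hf.2.1)
  set N : Set X := e '' {x | (b, x) ∈ μ} with hNdef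
  have hNB : ∀ x ∈ N, (b, x) ∈ μ := by
    rintro _ ⟨x, hx, rfl⟩
    exact heB hx
  have heN : ∀ x ∈ N, e x = x := by
    rintro _ ⟨x, hx, rfl⟩
    exact hee x hx
  have hbN : b ∈ N := ⟨b, h.refl b, heb⟩
  set T : Fin n → X → X := fun i x => t.eval (Function.update (fun _ => b) i x) with hT
  have hTpoly : ∀ i, IsPoly₁ S (T i) := fun i => polyFun_update t.polyFun _ i
  have hTB : ∀ i, Set.MapsTo (T i) {x | (b, x) ∈ μ} {x | (b, x) ∈ μ} := by
    intro i x hx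
    refine h.mem_class_of_eval fun j => ?_
    by_cases hj : j = i
    · subst hj
      simpa using hx
    · simpa [hj] using h.refl b
  have hTb : ∀ i, T i b = b := by
    intro i
    simp only [hT, Function.update_eq_self, h.taylor.1]
  have hn : 0 < n := by
    rcases Nat.eq_zero_or_pos n with rfl | hn
    · exact absurd ((h.taylor.1 a).symm.trans ((congrArg t.eval (Subsingleton.elim _ _)).trans
        (h.taylor.1 b))) hab
    · exact hn
  obtain ⟨i, -, hi⟩ := h.exists_two_coordinates he haB hab hea heb ⟨0, hn⟩
  obtain ⟨j, hji, hj⟩ := h.exists_two_coordinates he haB hab hea heb i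
  have hinv : ∀ k, e (T k a) ≠ b → ∃ q : X → X, IsPoly₁ S q ∧ Set.MapsTo q N N ∧ q b = b ∧
      ∀ x ∈ N, e (T k (q x)) = x := by
    intro k hk
    have hinj := (hkill (T k) ⟨hTpoly k, hTB k, hTb k⟩).resolve_right hk
    have hmaps : Set.MapsTo (e ∘ T k) N N := fun x hx => ⟨_, hTB k (hNB x hx), rfl⟩
    obtain ⟨m, hm, hidem⟩ := exists_iterate_idempotent (e ∘ T k)
    have hfix : ∀ x ∈ N, (e ∘ T k)^[m] x = x := fun x hx =>
      hinj.iterate hmaps m (hmaps.iterate m hx) hx (hidem x)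
    obtain ⟨l, rfl⟩ : ∃ l, m = l + 1 := ⟨m - 1, by omega⟩
    refine ⟨(e ∘ T k)^[l], IsPoly₁.iterate (he.comp (hTpoly k)) l, hmaps.iterate l,
      Function.iterate_fixed (by simp [hTb, heb]) l, fun x hx => ?_⟩
    have := hfix x hx
    rwa [Function.iterate_succ_apply'] at this
  obtain ⟨qi, hqi, hqiN, hqib, hqi'⟩ := hinv i hi
  obtain ⟨qj, hqj, hqjN, hqjb, hqj'⟩ := hinv j hj
  refine ⟨N, e, fun x y => e (t.eval
    (Function.update (Function.update (fun _ => b) i (qi x)) j (qj y))),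
    ⟨?_, hNB, hbN, fun x hx y hy => ⟨_, ?_, rfl⟩, fun x hx => ?_, fun x hx => ?_⟩, he,
    fun x hx => ⟨x, hx, rfl⟩, heN, a, ⟨a, haB, hea⟩, hab⟩
  · refine he.comp (PolyFun.comp (u := fun p : X × X =>
      Function.update (Function.update (fun _ => b) i (qi p.1)) j (qj p.2)) t.polyFun ?_)
    rintro _ ⟨k, rfl⟩
    by_cases hkj : k = j
    · subst hkj
      simpa [Function.comp_def] using hqj.comp (.var (by simp) : PolyFun S _ Prod.snd)
    · by_cases hki : k = i
      · subst hki
        simpa [Function.comp_def, hkj] using hqi.comp (.var (by simp) : PolyFun S _ Prod.fst)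
      · simpa [Function.comp_def, hkj, hki] using .const b
  · refine h.mem_class_of_eval fun k => ?_
    by_cases hkj : k = j
    · subst hkj
      simpa using hNB _ (hqjN hy)
    · by_cases hki : k = i
      · subst hki
        simpa [hkj] using hNB _ (hqiN hx)
      · simpa [hkj, hki] using h.refl b
  · simp only [hqib, Function.update_eq_self]
    exact hqj' x hx
  · simp only [hqjb]
    rw [Function.update_eq_self_iff.2 (by simp [hji])]
    exact hqi' x hx

end Trace

section Rectangular

variable {S : Signature} {X : Type} [SAlg S X] {n : ℕ} {t : STerm S n}
  {u v : Fin n → Fin n → Fin 2} {μ : Set (X × X)}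

/-- If the abelian congruence `μ` is an atom, polynomials followed by a retraction onto a
nontrivial subset of a `μ`-class separate the points of the class. -/
theorem IsAbelianTaylor.exists_separating (h : IsAbelianTaylor S t u v μ)
    (hmin : ∀ θ, IsCongruence S θ → (∃ x y, (x, y) ∈ θ ∧ x ≠ y) → μ ⊆ θ) {e : X → X} {a b : X}
    (hab : (b, a) ∈ μ) (he : e b ≠ e a) {x y : X} (hx : (b, x) ∈ μ) (hy : (b, y) ∈ μ)
    (hxy : x ≠ y) :
    ∃ f, IsPoly₁ S f ∧ (∀ z, (b, z) ∈ μ → (b, f z) ∈ μ) ∧ e (f x) ≠ e (f y) := by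
  by_contra! hall
  have hsub : ∀ f, IsPoly₁ S f → ∀ x y, (x, y) ∈ μ → (b, f x) ∈ μ → (b, f y) ∈ μ :=
    fun f hf x y hxy hx => h.cong.2.trans hx (h.cong.1.poly₁ h.refl hf hxy)
  have hθ : IsCongruence S {p | p ∈ μ ∧ ∀ f, IsPoly₁ S f → (b, f p.1) ∈ μ →
      e (f p.1) = e (f p.2)} := by
    have hrefl : ∀ x, (x, x) ∈ {p : X × X | p ∈ μ ∧ ∀ f, IsPoly₁ S f → (b, f p.1) ∈ μ →
        e (f p.1) = e (f p.2)} := fun x => ⟨h.refl x, fun _ _ _ => rfl⟩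
    have htrans : ∀ x y z, (x, y) ∈ {p : X × X | p ∈ μ ∧ ∀ f, IsPoly₁ S f → (b, f p.1) ∈ μ →
        e (f p.1) = e (f p.2)} → (y, z) ∈ {p : X × X | p ∈ μ ∧ ∀ f, IsPoly₁ S f →
          (b, f p.1) ∈ μ → e (f p.1) = e (f p.2)} → (x, z) ∈ {p : X × X | p ∈ μ ∧
            ∀ f, IsPoly₁ S f → (b, f p.1) ∈ μ → e (f p.1) = e (f p.2)} :=
      fun x y z h₁ h₂ => ⟨h.cong.2.trans h₁.1 h₂.1, fun f hf hb =>
        (h₁.2 f hf hb).trans (h₂.2 f hf (hsub f hf _ _ h₁.1 hb))⟩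
    refine ⟨isSubuniverse_of_poly₁ hrefl htrans fun g hg x y hxy =>
        ⟨h.cong.1.poly₁ h.refl hg hxy.1, fun f hf hb => hxy.2 _ (hf.comp hg) hb⟩,
      ⟨hrefl, fun {x y} hxy => ⟨h.cong.2.symm hxy.1, fun f hf hb =>
        (hxy.2 f hf (hsub f hf _ _ (h.cong.2.symm hxy.1) hb)).symm⟩,
        fun h₁ h₂ => htrans _ _ _ h₁ h₂⟩⟩
  refine he ((hmin _ hθ ⟨x, y, ⟨h.cong.2.trans (h.cong.2.symm hx) hy, fun f hf hb => ?_⟩, hxy⟩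
    hab).2 id IsPoly₁.id (h.refl b))
  exact hall f hf fun z hz => hsub f hf x z (h.cong.2.trans (h.cong.2.symm hx) hz) hb

/-- The polynomial maps from the `μ`-class of `b` to `N` that send `b` to itself. -/
abbrev PointedPoly (S : Signature) {X : Type} [SAlg S X] (μ : Set (X × X)) (N : Set X) (b : X) :
    Type :=
  {φ : X → X // IsPoly₁ S φ ∧ (∀ x, (b, x) ∈ μ → φ x ∈ N) ∧ φ b = b}

theorem IsAbelianTaylor.exists_pointedPoly [Finite X] (h : IsAbelianTaylor S t u v μ)
    (hmin : ∀ θ, IsCongruence S θ → (∃ x y, (x, y) ∈ θ ∧ x ≠ y) → μ ⊆ θ) {N : Set X} {b : X}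
    {add : X → X → X} (hN : IsPolyGroup S μ N b add) {e : X → X} (he : IsPoly₁ S e)
    (heN : ∀ x, (b, x) ∈ μ → e x ∈ N) {a : X} (hab : (b, a) ∈ μ) (hea : e b ≠ e a) {x y : X}
    (hx : (b, x) ∈ μ) (hy : (b, y) ∈ μ) (hxy : x ≠ y) :
    ∃ φ : PointedPoly S μ N b, φ.1 x ≠ φ.1 y := by
  obtain ⟨f, hf, hfB, hfxy⟩ := h.exists_separating hmin hab hea hx hy hxy
  have hfb := heN _ (hfB b (h.refl b))
  obtain ⟨c, hc, hcb⟩ := h.exists_neg hN hfb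
  refine ⟨⟨fun z => add (e (f z)) c, hN.poly.comp (he.comp hf) (.const c),
    fun z hz => hN.add_mem _ (heN _ (hfB z hz)) _ hc, ?_⟩, fun heq => hfxy ?_⟩
  · exact (h.add_comm hN hfb hc).trans hcb
  · exact h.add_right_cancel hN (heN _ (hfB x hx)) (heN _ (hfB y hy)) hc heq

/-- Polynomial operations from a `μ`-class to a polynomially definable group are affine. -/
theorem IsAbelianTaylor.map_eq_sum [Finite X] (h : IsAbelianTaylor S t u v μ) {N : Set X} {b : X}
    {add : X → X → X} (hN : IsPolyGroup S μ N b add) {G : (Fin n → X) → X}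
    (hG : PolyFun S (Set.range fun (i : Fin n) (w : Fin n → X) => w i) G)
    (hGN : ∀ w, (∀ i, (b, w i) ∈ μ) → G w ∈ N) (hGb : G (fun _ => b) = b) {x : Fin n → X}
    (hx : ∀ i, (b, x i) ∈ μ) {g : Fin n → N}
    (hg : ∀ i, (g i : X) = G (Function.update (fun _ => b) i (x i))) :
    letI := h.addCommGroup hN
    G x = ((∑ i, g i : N) : X) := by
  let := h.addCommGroup hN
  have key : ∀ s : Finset (Fin n),
      G (s.piecewise x fun _ => b) = ((∑ i ∈ s, g i : N) : X) := by
    intro s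
    induction s using Finset.induction_on with
    | empty =>
      rw [Finset.piecewise_empty, hGb, Finset.sum_empty]
      rfl
    | insert k s hk ih =>
      have hw : ∀ i, (b, s.piecewise x (fun _ => b) i) ∈ μ := fun i => by
        by_cases hi : i ∈ s
        · simpa [hi] using hx i
        · simpa [hi] using h.refl b
      have hw' : ∀ i, (b, Function.update (s.piecewise x fun _ => b) k (x k) i) ∈ μ := fun i => by
        by_cases hi : i = k
        · subst hi
          simpa using hx i
        · simpa [hi] using hw i
      have hGw := hGN _ hw
      have hGw' := hGN _ hw'
      have hM : TCMatrix S μ b b (x k) (x k)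
          (add (G (Function.update (s.piecewise x fun _ => b) k b)) b)
          (add (G (Function.update (fun _ => b) k b)) (G (s.piecewise x fun _ => b)))
          (add (G (Function.update (s.piecewise x fun _ => b) k (x k))) b)
          (add (G (Function.update (fun _ => b) k (x k))) (G (s.piecewise x fun _ => b))) := by
        refine .poly₂ h.refl hN.poly (TCMatrix.polyFun h.refl hG ?_) (.par (hN.sub _ hGw))
        rintro _ ⟨i, rfl⟩
        by_cases hi : i = k
        · subst hi
          simpa using TCMatrix.base
        · simpa [hi] using TCMatrix.par (h.cong.2.symm (hw i))
      have hupd : Function.update (s.piecewise x fun _ => b) k b = s.piecewise x fun _ => b :=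
        Function.update_eq_self_iff.2 (by simp [hk])
      have := h.abelian _ _ _ _ _ _ (hx k) hM (by
        rw [hupd, Function.update_eq_self, hGb, hN.add_zero _ hGw, hN.zero_add _ hGw])
      rw [hN.add_zero _ hGw', ← hg, ih] at this
      rw [Finset.piecewise_insert, this, Finset.sum_insert hk]
      rfl
  have := key Finset.univ
  rwa [Finset.piecewise_univ] at this

/-- Reflexive compatible relations below an abelian atom are rectangular. -/
theorem IsAbelianTaylor.rectangular [Finite X] (h : IsAbelianTaylor S t u v μ)
    (hmin : ∀ θ, IsCongruence S θ → (∃ x y, (x, y) ∈ θ ∧ x ≠ y) → μ ⊆ θ) {L : Set (X × X)}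
    (hL : IsSubuniverse S L) (hrefl : ∀ x, (x, x) ∈ L) (hLμ : L ⊆ μ) {x y z w : X}
    (hxy : (x, y) ∈ L) (hzy : (z, y) ∈ L) (hzw : (z, w) ∈ L) : (x, w) ∈ L := by
  obtain ⟨b, rfl⟩ : ∃ b, b = x := ⟨x, rfl⟩
  have hby := hLμ hxy
  have hbz := h.cong.2.trans hby (h.cong.2.symm (hLμ hzy))
  have hbw := h.cong.2.trans hbz (hLμ hzw)
  by_cases hB : ∃ a, (b, a) ∈ μ ∧ a ≠ b
  swap
  · push Not at hB
    rw [hB w hbw]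
    exact hrefl b
  obtain ⟨N, e, add, hN, he, heN, heN', a, haN, hab⟩ := h.exists_polyGroup hB
  let := h.addCommGroup hN
  have hea : e b ≠ e a := by
    rw [heN' a haN, heN' b hN.zero_mem]
    exact hab.symm
  let T : Fin n → X → X := fun i x => t.eval (Function.update (fun _ => b) i x)
  have hT : ∀ i x, (b, x) ∈ μ → (b, T i x) ∈ μ := fun i x hx => by
    refine h.mem_class_of_eval fun j => ?_
    by_cases hj : j = i
    · subst hj
      simpa using hx
    · simpa [hj] using h.refl b
  let F := PointedPoly S μ N b
  let T' : Fin n → F → F := fun i φ => ⟨φ.1 ∘ T i,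
    φ.2.1.comp (polyFun_update t.polyFun _ i), fun x hx => φ.2.2.1 _ (hT i x hx), by
      simp only [T, Function.comp_apply, Function.update_eq_self, h.taylor.1, φ.2.2.2]⟩
  let α : Fin n → (F → N) →+ (F → N) := fun i =>
    { toFun := fun v φ => v (T' i φ)
      map_zero' := rfl
      map_add' := fun _ _ => rfl }
  let ι : {x // (b, x) ∈ μ} → F → N := fun x φ => ⟨φ.1 x, φ.2.2.1 x x.2⟩
  have hι : Function.Injective ι := by
    intro x y hxy
    by_contra hne
    obtain ⟨φ, hφ⟩ := h.exists_pointedPoly hmin hN he heN (hN.sub a haN) hea x.2 y.2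
      fun h => hne (Subtype.ext h)
    exact hφ (congrArg Subtype.val (congrFun hxy φ))
  have hι0 : ι ⟨b, h.refl b⟩ = 0 := funext fun φ => Subtype.ext φ.2.2.2
  have hιt : ∀ x : Fin n → {x // (b, x) ∈ μ},
      ι ⟨t.eval fun i => x i, h.mem_class_of_eval fun i => (x i).2⟩ = ∑ i, α i (ι (x i)) := by
    intro x
    funext φ
    rw [Finset.sum_apply]
    refine Subtype.ext (h.map_eq_sum hN (φ.2.1.comp t.polyFun)
      (fun w hw => φ.2.2.1 _ (h.mem_class_of_eval hw)) ?_ (fun i => (x i).2) fun i => rfl)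
    simp only [Function.comp_apply, h.taylor.1, φ.2.2.2]
  let β : Fin n → (F → N) × (F → N) →+ (F → N) × (F → N) := fun i => (α i).prodMap (α i)
  let D : Set ((F → N) × (F → N)) :=
    {d | ∃ x y : {x // (b, x) ∈ μ}, (x.1, y.1) ∈ L ∧ d = (ι x, ι y)}
  have hpart : ∀ (x : {x // (b, x) ∈ μ}) (P : Fin n → Prop) [DecidablePred P],
      ∑ j with P j, α j (ι x) =
        ι ⟨t.eval fun j => if P j then x.1 else b, h.mem_class_of_eval fun j => by
          split_ifs
          exacts [x.2, h.refl b]⟩ := by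
    intro x P _
    have := hιt fun j => if P j then x else ⟨b, h.refl b⟩
    rw [Finset.sum_filter]
    refine Eq.trans ?_ (this.symm.trans ?_)
    · refine Finset.sum_congr rfl fun j _ => ?_
      split_ifs
      · rfl
      · rw [hι0, map_zero]
    · congr 3
      funext j
      split_ifs <;> rfl
  have hbal : ∀ i, ∀ d ∈ D,
      ∑ j with u i j = 0, β j d = ∑ j with v i j = 0, β j d := by
    rintro i _ ⟨x, y, -, rfl⟩
    have : ∀ x : {x // (b, x) ∈ μ},
        ∑ j with u i j = 0, α j (ι x) = ∑ j with v i j = 0, α j (ι x) := fun x => by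
      rw [hpart, hpart]
      exact congrArg ι (Subtype.ext (h.taylor.2 i x b))
    refine Prod.ext ?_ ?_
    · rw [Prod.fst_sum, Prod.fst_sum]
      exact this x
    · rw [Prod.snd_sum, Prod.snd_sum]
      exact this y
  have hD : IsTaylorSum β
      (fun i => if u i i = 0 then Finset.univ.filter fun j => u i j = 0
        else Finset.univ.filter fun j => v i j = 0)
      (fun i => if u i i = 0 then Finset.univ.filter fun j => v i j = 0
        else Finset.univ.filter fun j => u i j = 0) D := by
    refine ⟨fun i => ?_, fun i => ?_, ⟨⟨b, h.refl b⟩, ⟨b, h.refl b⟩, hrefl b, ?_⟩, fun d hd => ?_,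
      ?_, fun i d hd => ?_⟩
    · have := h.ne i
      split_ifs with hi
      · simpa using hi
      · simp only [Finset.mem_filter, Finset.mem_univ, true_and]
        omega
    · have := h.ne i
      split_ifs with hi
      · simp only [Finset.mem_filter, Finset.mem_univ, true_and]
        omega
      · simpa using hi
    · rw [hι0]
      rfl
    · choose x y hxy hd using hd
      refine ⟨⟨t.eval fun i => x i, h.mem_class_of_eval fun i => (x i).2⟩,
        ⟨t.eval fun i => y i, h.mem_class_of_eval fun i => (y i).2⟩,
        hL.polyFun hrefl t.polyFun (y := fun i => (x i).1) (z := fun i => (y i).1) ?_, ?_⟩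
      · rintro _ ⟨i, rfl⟩
        exact hxy i
      · rw [hιt, hιt]
        refine Prod.ext ?_ ?_
        · rw [Prod.fst_sum]
          exact Finset.sum_congr rfl fun i _ => by rw [hd i]; rfl
        · rw [Prod.snd_sum]
          exact Finset.sum_congr rfl fun i _ => by rw [hd i]; rfl
    · rintro _ ⟨x, y, -, rfl⟩
      have : ∀ x : {x // (b, x) ∈ μ}, ∑ i, α i (ι x) = ι x := fun x => by
        rw [← hιt fun _ => x]
        exact congrArg ι (Subtype.ext (h.taylor.1 x))
      refine Prod.ext ?_ ?_
      · rw [Prod.fst_sum]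
        exact this x
      · rw [Prod.snd_sum]
        exact this y
    · split_ifs
      exacts [hbal i d hd, (hbal i d hd).symm]
  obtain ⟨E, hE⟩ := hD.eq_addSubgroup
  have hmem : ∀ x y : {x // (b, x) ∈ μ}, (x.1, y.1) ∈ L → (ι x, ι y) ∈ E := fun x y hxy => by
    rw [← SetLike.mem_coe, hE]
    exact ⟨x, y, hxy, rfl⟩
  have := E.add_mem (E.sub_mem (hmem ⟨b, h.refl b⟩ ⟨y, hby⟩ hxy) (hmem ⟨z, hbz⟩ ⟨y, hby⟩ hzy))
    (hmem ⟨z, hbz⟩ ⟨w, hbw⟩ hzw)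
  rw [Prod.mk_sub_mk, Prod.mk_add_mk, sub_add_cancel, sub_self, zero_add, ← SetLike.mem_coe,
    hE] at this
  obtain ⟨x', w', hL', heq⟩ := this
  rw [Prod.mk.injEq] at heq
  rwa [← hι heq.1, ← hι heq.2] at hL'

/-- Reflexive compatible relations below an abelian atom are congruences. -/
theorem IsAbelianTaylor.isCongruence [Finite X] (h : IsAbelianTaylor S t u v μ)
    (hmin : ∀ θ, IsCongruence S θ → (∃ x y, (x, y) ∈ θ ∧ x ≠ y) → μ ⊆ θ) {L : Set (X × X)}
    (hL : IsSubuniverse S L) (hrefl : ∀ x, (x, x) ∈ L) (hLμ : L ⊆ μ) : IsCongruence S L :=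
  ⟨hL, hrefl, fun hxy => h.rectangular hmin hL hrefl hLμ (hrefl _) hxy (hrefl _),
    fun hxy hyz => h.rectangular hmin hL hrefl hLμ hxy (hrefl _) hyz⟩

end Rectangular

section TermCondition

variable {S : Signature} {A : Type} [SAlg S A] {φ θ δ : Set (A × A)}

theorem STerm.tcMatrix {n : ℕ} (t : STerm S (n + 1)) {a b : A} {c d : Fin n → A}
    (h : ∀ i, (c i, d i) ∈ θ) :
    TCMatrix S θ a a b b (t.eval (Fin.cons a c)) (t.eval (Fin.cons a d)) (t.eval (Fin.cons b c))
      (t.eval (Fin.cons b d)) := by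
  induction t with
  | var i =>
    refine Fin.cases ?_ (fun i => ?_) i
    · exact .base
    · exact .par (h i)
  | app o ts ih => exact .app o _ _ _ _ ih

theorem TCMatrix.exists_term {n : ℕ} {c d : Fin n → A}
    (h : ∀ x y, (x, y) ∈ θ → ∃ i, c i = x ∧ d i = y) {a b p q r s : A}
    (hM : TCMatrix S θ a a b b p q r s) :
    ∃ t : STerm S (n + 1), t.eval (Fin.cons a c) = p ∧ t.eval (Fin.cons a d) = q ∧
      t.eval (Fin.cons b c) = r ∧ t.eval (Fin.cons b d) = s := by
  induction hM with
  | base => exact ⟨.var 0, rfl, rfl, rfl, rfl⟩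
  | par hxy =>
    obtain ⟨i, rfl, rfl⟩ := h _ _ hxy
    exact ⟨.var i.succ, rfl, rfl, rfl, rfl⟩
  | app o p q r s _ ih =>
    choose t hp hq hr hs using ih
    exact ⟨.app o t, congrArg _ (funext hp), congrArg _ (funext hq), congrArg _ (funext hr),
      congrArg _ (funext hs)⟩

/-- On a finite algebra, the term condition amounts to an implication for the matrices in
the subuniverses generated by `(a, a, b, b)` and the `(x, y, x, y)` with `(x, y) ∈ θ`. -/
theorem centralizes_iff_tcMatrix [Finite A] :
    Centralizes S φ θ δ ↔ ∀ a b p q r s, (a, b) ∈ φ → TCMatrix S θ a a b b p q r s →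
      (p, q) ∈ δ → (r, s) ∈ δ := by
  constructor
  · intro h a b p q r s hab hM hpq
    obtain ⟨n, ⟨f⟩⟩ := Finite.exists_equiv_fin θ
    obtain ⟨t, rfl, rfl, rfl, rfl⟩ := hM.exists_term (c := fun i => (f.symm i).1.1)
      (d := fun i => (f.symm i).1.2) fun x y hxy => ⟨f ⟨_, hxy⟩, by simp, by simp⟩
    exact h n t a b _ _ hab (fun i => (f.symm i).2) hpq
  · intro h n t a b c d hab hcd hpq
    exact h a b _ _ _ _ hab (t.tcMatrix hcd) hpq

end TermCondition

section Quotient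

variable {S : Signature} {A X : Type} [SAlg S A] [SAlg S X] {ρ θ : Set (A × A)} {π : A → X}

/-- `π` is a surjective homomorphism with kernel `ρ`. -/
structure IsQuotientMap (S : Signature) {A X : Type} [SAlg S A] [SAlg S X] (ρ : Set (A × A))
    (π : A → X) : Prop where
  surj : Function.Surjective π
  map : ∀ (o : S.ops) (x : Fin (S.arity o) → A),
    π (SAlg.interp o x) = SAlg.interp o fun i => π (x i)
  eq_iff : ∀ a b, π a = π b ↔ (a, b) ∈ ρ

theorem IsCongruence.mk_eq_mk (hρ : IsCongruence S ρ) {a b : A} :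
    ConQuot.mk ρ a = ConQuot.mk ρ b ↔ (a, b) ∈ ρ :=
  Quot.eq.trans hρ.2.eqvGen_iff

theorem IsCongruence.isQuotientMap (hρ : IsCongruence S ρ) :
    letI := quotAlg ‹SAlg S A› ρ
    IsQuotientMap S ρ (ConQuot.mk ρ) := by
  let := quotAlg ‹SAlg S A› ρ
  refine ⟨Quot.mk_surjective, fun o x => ?_, fun a b => hρ.mk_eq_mk⟩
  refine hρ.mk_eq_mk.2 (hρ.1 o (fun i => (x i, _)) fun i => hρ.2.symm (hρ.mk_eq_mk.1 ?_))
  exact Classical.choose_spec (Quot.exists_rep (ConQuot.mk ρ (x i)))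

theorem IsQuotientMap.map_eval (hπ : IsQuotientMap S ρ π) {n : ℕ} (t : STerm S n)
    (w : Fin n → A) : π (t.eval w) = t.eval fun i => π (w i) := by
  induction t with
  | var i => rfl
  | app o ts ih => exact (hπ.map o _).trans (congrArg _ (funext ih))

theorem IsQuotientMap.taylorOn (hπ : IsQuotientMap S ρ π) {n : ℕ} {t : STerm S n}
    {u v : Fin n → Fin n → Fin 2} (h : TaylorOn S A t u v) : TaylorOn S X t u v := by
  refine ⟨fun x => ?_, fun i x y => ?_⟩
  · obtain ⟨a, rfl⟩ := hπ.surj x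
    rw [← hπ.map_eval t fun _ => a, h.1]
  · obtain ⟨a, rfl⟩ := hπ.surj x
    obtain ⟨b, rfl⟩ := hπ.surj y
    simp only [← apply_ite π]
    rw [← hπ.map_eval, ← hπ.map_eval, h.2]

theorem IsQuotientMap.mem_image (hπ : IsQuotientMap S ρ π) (hθ : rcomp ρ (rcomp θ ρ) ⊆ θ)
    {a b : A} : (π a, π b) ∈ Prod.map π π '' θ ↔ (a, b) ∈ θ := by
  refine ⟨?_, fun h => ⟨_, h, rfl⟩⟩
  rintro ⟨⟨a', b'⟩, h, heq⟩
  obtain ⟨ha, hb⟩ := Prod.mk.inj heq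
  exact hθ ⟨a', (hπ.eq_iff _ _).1 ha.symm, b', h, (hπ.eq_iff _ _).1 hb⟩

theorem IsQuotientMap.isSubuniverse_image (hπ : IsQuotientMap S ρ π) (hθ : IsSubuniverse S θ) :
    IsSubuniverse S (Prod.map π π '' θ) := by
  intro o x hx
  choose y hy hyx using hx
  refine ⟨_, hθ o y hy, ?_⟩
  obtain rfl : (fun i => Prod.map π π (y i)) = x := funext hyx
  exact Prod.ext (hπ.map o _) (hπ.map o _)

theorem IsCongruence.rcomp_subset (hθ : IsCongruence S θ) (h : ρ ⊆ θ) :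
    rcomp ρ (rcomp θ ρ) ⊆ θ := by
  rintro ⟨a, b⟩ ⟨a', ha, b', hab, hb⟩
  exact hθ.2.trans (h ha) (hθ.2.trans hab (h hb))

theorem IsQuotientMap.isCongruence_image (hπ : IsQuotientMap S ρ π)
    (hθ : IsCongruence S θ) (h : ρ ⊆ θ) : IsCongruence S (Prod.map π π '' θ) := by
  have hsub := hθ.rcomp_subset h
  refine ⟨hπ.isSubuniverse_image hθ.1, fun x => ?_, fun {x y} hxy => ?_, fun {x y z} hxy hyz => ?_⟩
  · obtain ⟨a, rfl⟩ := hπ.surj x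
    exact (hπ.mem_image hsub).2 (hθ.2.refl a)
  · obtain ⟨a, rfl⟩ := hπ.surj x
    obtain ⟨b, rfl⟩ := hπ.surj y
    exact (hπ.mem_image hsub).2 (hθ.2.symm ((hπ.mem_image hsub).1 hxy))
  · obtain ⟨a, rfl⟩ := hπ.surj x
    obtain ⟨b, rfl⟩ := hπ.surj y
    obtain ⟨c, rfl⟩ := hπ.surj z
    exact (hπ.mem_image hsub).2 (hθ.2.trans ((hπ.mem_image hsub).1 hxy)
      ((hπ.mem_image hsub).1 hyz))

theorem IsQuotientMap.isCongruence_preimage (hπ : IsQuotientMap S ρ π) {θ : Set (X × X)}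
    (hθ : IsCongruence S θ) : IsCongruence S (Prod.map π π ⁻¹' θ) := by
  refine ⟨fun o x hx => ?_, fun a => hθ.2.refl (π a), fun h => hθ.2.symm h,
    fun h₁ h₂ => hθ.2.trans h₁ h₂⟩
  have := hθ.1 o (fun i => Prod.map π π (x i)) hx
  rw [Set.mem_preimage]
  convert this using 1
  exact Prod.ext (hπ.map o _) (hπ.map o _)

theorem IsQuotientMap.exists_tcMatrix (hπ : IsQuotientMap S ρ π) {a b c d : A} {p q r s : X}
    (h : TCMatrix S (Prod.map π π '' θ) (π a) (π b) (π c) (π d) p q r s) :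
    ∃ p' q' r' s', TCMatrix S θ a b c d p' q' r' s' ∧ π p' = p ∧ π q' = q ∧ π r' = r ∧
      π s' = s := by
  induction h with
  | base => exact ⟨_, _, _, _, .base, rfl, rfl, rfl, rfl⟩
  | par hxy =>
    obtain ⟨⟨x', y'⟩, hxy, heq⟩ := hxy
    obtain ⟨rfl, rfl⟩ := Prod.mk.inj heq
    exact ⟨_, _, _, _, .par hxy, rfl, rfl, rfl, rfl⟩
  | app o p q r s _ ih =>
    choose p' q' r' s' hM hp hq hr hs using ih
    exact ⟨_, _, _, _, .app o p' q' r' s' hM, (hπ.map o _).trans (congrArg _ (funext hp)),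
      (hπ.map o _).trans (congrArg _ (funext hq)), (hπ.map o _).trans (congrArg _ (funext hr)),
      (hπ.map o _).trans (congrArg _ (funext hs))⟩

end Quotient

section Cover

variable {S : Signature} {A : Type} [SAlg S A] {ρ ρplus : Set (A × A)}

/-- In a finite Taylor algebra there is no saturated subuniverse strictly between `ρ` and an
abelian unique upper cover of `ρ`. -/
theorem MeetIrredWith.eq_of_saturated [Finite A] (hTay : IsTaylorAlg S A)
    (hmi : MeetIrredWith S ρ ρplus) (hab : Centralizes S ρplus ρplus ρ) {L : Set (A × A)}
    (hL : IsSubuniverse S L) (hsat : Saturated ρ L) (hρL : ρ ⊂ L) (hLρ : L ⊆ ρplus) :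
    L = ρplus := by
  obtain ⟨hρ, -, hρplus, hlt, hcov⟩ := hmi
  obtain ⟨n, t, u, v, -, hne, htay⟩ := hTay
  let := quotAlg ‹SAlg S A› ρ
  have hπ : IsQuotientMap S ρ (ConQuot.mk ρ) := hρ.isQuotientMap
  have : Finite (ConQuot ρ) := Finite.of_surjective _ hπ.surj
  have hsubL : rcomp ρ (rcomp L ρ) ⊆ L := hsat.subset
  have hsubρ := hρplus.rcomp_subset hlt.subset
  have hμ : IsAbelianTaylor S t u v (Prod.map (ConQuot.mk ρ) (ConQuot.mk ρ) '' ρplus) := by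
    refine ⟨hπ.isCongruence_image hρplus hlt.subset, hne, hπ.taylorOn htay, ?_⟩
    intro x y p q r s hxy hM hpq
    obtain ⟨a, rfl⟩ := hπ.surj x
    obtain ⟨b, rfl⟩ := hπ.surj y
    obtain ⟨p', q', r', s', hM', rfl, rfl, rfl, rfl⟩ := hπ.exists_tcMatrix hM
    exact (hπ.eq_iff _ _).2 (centralizes_iff_tcMatrix.1 hab a b _ _ _ _
      ((hπ.mem_image hsubρ).1 hxy) hM' ((hπ.eq_iff _ _).1 hpq))
  have hmin : ∀ θ, IsCongruence S θ → (∃ x y, (x, y) ∈ θ ∧ x ≠ y) →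
      Prod.map (ConQuot.mk ρ) (ConQuot.mk ρ) '' ρplus ⊆ θ := by
    rintro θ hθ ⟨x, y, hxy, hne⟩
    obtain ⟨a, rfl⟩ := hπ.surj x
    obtain ⟨b, rfl⟩ := hπ.surj y
    rw [Set.image_subset_iff]
    refine hcov _ (hπ.isCongruence_preimage hθ) ⟨?_, fun hsub => hne ?_⟩
    · rintro ⟨a, b⟩ h
      rw [Set.mem_preimage, Prod.map_apply, (hπ.eq_iff a b).2 h]
      exact hθ.2.refl _
    · exact (hπ.eq_iff a b).2 (@hsub (a, b) hxy)
  have hcong := hπ.isCongruence_preimage (hμ.isCongruence hmin (hπ.isSubuniverse_image hL)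
    (fun x => by
      obtain ⟨a, rfl⟩ := hπ.surj x
      exact ⟨(a, a), hρL.subset (hρ.2.refl a), rfl⟩)
    (Set.image_mono hLρ))
  have hpre : Prod.map (ConQuot.mk ρ) (ConQuot.mk ρ) ⁻¹'
      (Prod.map (ConQuot.mk ρ) (ConQuot.mk ρ) '' L) = L :=
    Set.ext fun _ => hπ.mem_image hsubL
  rw [hpre] at hcong
  exact hLρ.antisymm (hcov L hcong hρL)

theorem IsCongruence.saturated {θ : Set (A × A)} (hρ : IsCongruence S ρ) (hθ : IsCongruence S θ)
    (h : ρ ⊆ θ) : Saturated ρ θ :=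
  (hθ.rcomp_subset h).antisymm fun p hp => ⟨p.1, hρ.2.refl _, p.2, hp, hρ.2.refl _⟩

theorem MeetIrredWith.covPlus_eq [Finite A] (hTay : IsTaylorAlg S A)
    (hmi : MeetIrredWith S ρ ρplus) (hab : Centralizes S ρplus ρplus ρ) :
    CovPlus S ρ ρplus = {ρplus} := by
  ext τ
  constructor
  · rintro ⟨⟨hτ, hsat, hlt, -⟩, hle⟩
    exact hmi.eq_of_saturated hTay hab hτ hsat hlt hle
  · rintro rfl
    exact ⟨⟨hmi.2.2.1.1, hmi.1.saturated hmi.2.2.1 hmi.2.2.2.1.subset, hmi.2.2.2.1,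
      fun L hL hsat hlt hle => hmi.eq_of_saturated hTay hab hL hsat hlt hle⟩, subset_rfl⟩

end Cover

section Syntactic

variable {S : Signature}

/-- The syntactic congruence of a subset `P` of an algebra. -/
def syntacticCon (S : Signature) {X : Type} [SAlg S X] (P : Set X) : Set (X × X) :=
  {p | ∀ f, IsPoly₁ S f → (f p.1 ∈ P ↔ f p.2 ∈ P)}

theorem isCongruence_syntacticCon {X : Type} [SAlg S X] (P : Set X) :
    IsCongruence S (syntacticCon S P) :=
  ⟨isSubuniverse_of_poly₁ (fun _ _ _ => Iff.rfl)
      (fun _ _ _ h₁ h₂ f hf => (h₁ f hf).trans (h₂ f hf))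
      fun _ hg _ _ h _ hf => h _ (hf.comp hg),
    fun _ _ _ => Iff.rfl, fun h f hf => (h f hf).symm,
    fun h₁ h₂ f hf => (h₁ f hf).trans (h₂ f hf)⟩

variable {A : Type} [SAlg S A] {ρ θ : Set (A × A)}

theorem isConOn_of_isCongruence (hθ : IsSubuniverse S θ) {Θ : Set (θ × θ)}
    (hΘ : letI := subAlg θ hθ; IsCongruence S Θ) :
    IsConOn S θ {P | ∃ (h₁ : P.1 ∈ θ) (h₂ : P.2 ∈ θ), (⟨P.1, h₁⟩, ⟨P.2, h₂⟩) ∈ Θ} := by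
  let := subAlg θ hθ
  refine ⟨fun P ⟨h₁, h₂, _⟩ => ⟨h₁, h₂⟩, fun o x hx => ?_, fun p hp => ⟨hp, hp, hΘ.2.refl _⟩,
    fun p q ⟨h₁, h₂, h⟩ => ⟨h₂, h₁, hΘ.2.symm h⟩,
    fun p q r ⟨h₁, _, h⟩ ⟨_, h₂, h'⟩ => ⟨h₁, h₂, hΘ.2.trans h h'⟩⟩
  choose h₁ h₂ h using hx
  exact ⟨_, _, hΘ.1 o _ h⟩

/-- The largest congruence of `A(θ)` for which `ρ` is a union of classes. -/
def syntacticConOn (S : Signature) {A : Type} [SAlg S A] (ρ : Set (A × A)) {θ : Set (A × A)}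
    (hθ : IsSubuniverse S θ) : Set ((A × A) × (A × A)) :=
  letI := subAlg θ hθ
  {P | ∃ (h₁ : P.1 ∈ θ) (h₂ : P.2 ∈ θ),
    (⟨P.1, h₁⟩, ⟨P.2, h₂⟩) ∈ syntacticCon S (Subtype.val ⁻¹' ρ : Set θ)}

theorem isConOn_syntacticConOn (hθ : IsSubuniverse S θ) : IsConOn S θ (syntacticConOn S ρ hθ) :=
  letI := subAlg θ hθ
  isConOn_of_isCongruence hθ (isCongruence_syntacticCon _)

theorem tcMatrix_of_polyFun (hθ : IsSubuniverse S θ) {f : θ → θ}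
    (hf : letI := subAlg θ hθ; IsPoly₁ S f) (x y : θ) :
    TCMatrix S θ x.1.1 x.1.2 y.1.1 y.1.2 (f x).1.1 (f x).1.2 (f y).1.1 (f y).1.2 := by
  let := subAlg θ hθ
  induction hf with
  | var hf =>
    rw [Set.mem_singleton_iff.1 hf]
    exact .base
  | const c => exact .par c.2
  | app o f _ ih => exact .app o _ _ _ _ ih

theorem TCMatrix.exists_polyFun (hθ : IsSubuniverse S θ) {x y : θ} {p q r s : A}
    (h : TCMatrix S θ x.1.1 x.1.2 y.1.1 y.1.2 p q r s) :
    letI := subAlg θ hθ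
    ∃ f : θ → θ, IsPoly₁ S f ∧ (f x).1 = (p, q) ∧ (f y).1 = (r, s) := by
  let := subAlg θ hθ
  induction h with
  | base => exact ⟨id, IsPoly₁.id, rfl, rfl⟩
  | par h => exact ⟨fun _ => ⟨_, h⟩, .const _, rfl, rfl⟩
  | app o p q r s _ ih =>
    choose f hf hx hy using ih
    refine ⟨_, .app o f hf, Prod.ext ?_ ?_, Prod.ext ?_ ?_⟩
    exacts [congrArg (SAlg.interp o) (funext fun i => congrArg Prod.fst (hx i)),
      congrArg (SAlg.interp o) (funext fun i => congrArg Prod.snd (hx i)),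
      congrArg (SAlg.interp o) (funext fun i => congrArg Prod.fst (hy i)),
      congrArg (SAlg.interp o) (funext fun i => congrArg Prod.snd (hy i))]

theorem mem_syntacticConOn_iff (hθ : IsSubuniverse S θ) {a b c d : A} (hab : (a, b) ∈ θ)
    (hcd : (c, d) ∈ θ) : ((a, b), (c, d)) ∈ syntacticConOn S ρ hθ ↔
      ∀ p q r s, TCMatrix S θ a b c d p q r s → ((p, q) ∈ ρ ↔ (r, s) ∈ ρ) := by
  constructor
  · rintro ⟨_, _, h⟩ p q r s hM
    obtain ⟨f, hf, hx, hy⟩ := TCMatrix.exists_polyFun hθ (x := ⟨_, hab⟩) (y := ⟨_, hcd⟩) hM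
    have := h f hf
    rwa [Set.mem_preimage, Set.mem_preimage, hx, hy] at this
  · exact fun h => ⟨hab, hcd, fun f hf => h _ _ _ _
      (tcMatrix_of_polyFun hθ hf ⟨(a, b), hab⟩ ⟨(c, d), hcd⟩)⟩

theorem TCMatrix.swap {a b c d p q r s : A} (h : TCMatrix S θ a b c d p q r s) :
    TCMatrix S θ c d a b r s p q := by
  induction h with
  | base => exact .base
  | par h => exact .par h
  | app o p q r s _ ih => exact .app o _ _ _ _ ih

theorem mem_centralizer_iff [Finite A] (hθ : IsCongruence S θ) {a b : A} :
    (a, b) ∈ centralizer S ρ θ ↔ ((a, a), (b, b)) ∈ syntacticConOn S ρ hθ.1 := by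
  have hiff : ∀ a b, ((a, a), (b, b)) ∈ syntacticConOn S ρ hθ.1 ↔
      ∀ p q r s, TCMatrix S θ a a b b p q r s → ((p, q) ∈ ρ ↔ (r, s) ∈ ρ) :=
    fun a b => mem_syntacticConOn_iff hθ.1 (hθ.2.refl a) (hθ.2.refl b)
  constructor
  · rintro ⟨φ, ⟨hφ, hC⟩, hab⟩
    rw [centralizes_iff_tcMatrix] at hC
    exact (hiff a b).2 fun p q r s hM =>
      ⟨hC a b p q r s hab hM, hC b a r s p q (hφ.2.symm hab) hM.swap⟩
  · intro hab
    obtain ⟨-, hsub, hrefl, hsymm, htrans⟩ := isConOn_syntacticConOn (ρ := ρ) hθ.1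
    refine ⟨{x | ((x.1, x.1), (x.2, x.2)) ∈ syntacticConOn S ρ hθ.1},
      ⟨⟨fun o x hx => hsub o (fun i => (((x i).1, (x i).1), ((x i).2, (x i).2))) hx,
        fun a => hrefl _ (hθ.2.refl a), fun h => hsymm _ _ h, fun h₁ h₂ => htrans _ _ _ h₁ h₂⟩,
      centralizes_iff_tcMatrix.2 fun a b p q r s h hM => ((hiff a b).1 h p q r s hM).1⟩, hab⟩

theorem isConOn_deltaCon {α : Set (A × A)} (h : ∃ Δ, IsConOn S θ Δ ∧
    ∀ a b : A, (a, b) ∈ α → ((a, a), (b, b)) ∈ Δ) : IsConOn S θ (DeltaCon S θ α) := by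
  obtain ⟨Δ, hΔ⟩ := h
  exact ⟨fun p hp => hΔ.1.1 (hp Δ hΔ), fun o x hx Γ hΓ => hΓ.1.2.1 o x fun i => hx i Γ hΓ,
    fun p hp Γ hΓ => hΓ.1.2.2.1 p hp, fun p q h Γ hΓ => hΓ.1.2.2.2.1 p q (h Γ hΓ),
    fun p q r h₁ h₂ Γ hΓ => hΓ.1.2.2.2.2 p q r (h₁ Γ hΓ) (h₂ Γ hΓ)⟩

end Syntactic

section Bridge

variable {S : Signature} {A : Type} [SAlg S A] {ρ θ : Set (A × A)}

theorem IsBridgeLR.btr_subset_centralizer [Finite A] (hθ : IsCongruence S θ)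
    {T : Set (A × A × A × A)} (hT : IsBridgeLR S ρ ρ θ θ T) (hrefl : ReflBridge T) :
    btr T ⊆ centralizer S ρ θ := by
  obtain ⟨⟨hsub, -, -, -, -, hiff⟩, hpr, -⟩ := hT
  rintro ⟨a, b⟩ hab
  rw [mem_centralizer_iff hθ, mem_syntacticConOn_iff hθ.1 (hθ.2.refl a) (hθ.2.refl b)]
  intro p q r s hM
  have : (p, q, r, s) ∈ bComp T (bConv T) := by
    induction hM with
    | base => exact ⟨b, b, hab, hrefl b⟩
    | @par x y h =>
      rw [← hpr] at h
      obtain ⟨c, d, h⟩ := h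
      exact ⟨c, d, h, h⟩
    | app o p q r s _ ih =>
      choose c d h₁ h₂ using ih
      exact ⟨_, _, hsub o _ h₁, hsub o _ h₂⟩
  obtain ⟨c, d, h₁, h₂⟩ := this
  exact (hiff _ _ _ _ h₁).trans (hiff _ _ _ _ h₂).symm

theorem isSubuniverse_bComp {T T' : Set (A × A × A × A)} (hT : IsSubuniverse S T)
    (hT' : IsSubuniverse S T') : IsSubuniverse S (bComp T T') := by
  intro o x hx
  choose c d h₁ h₂ using hx
  exact ⟨_, _, hT o (fun i => ((x i).1, (x i).2.1, c i, d i)) h₁,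
    hT' o (fun i => (c i, d i, (x i).2.2.1, (x i).2.2.2)) h₂⟩

theorem isSubuniverse_idBridge (hρ : IsSubuniverse S ρ) (hθ : IsSubuniverse S θ) :
    IsSubuniverse S (idBridge ρ θ) := fun o _ hx =>
  ⟨hθ o _ fun i => (hx i).1, hθ o _ fun i => (hx i).2.1, hρ o _ fun i => (hx i).2.2.1,
    hρ o _ fun i => (hx i).2.2.2⟩

theorem isConOn_deltaCon_centralizer [Finite A] (hθ : IsCongruence S θ) :
    IsConOn S θ (DeltaCon S θ (centralizer S ρ θ)) :=
  isConOn_deltaCon ⟨_, isConOn_syntacticConOn hθ.1, fun _ _ => (mem_centralizer_iff hθ).1⟩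

theorem mem_iff_mem_of_mem_deltaCon [Finite A] (hθ : IsCongruence S θ) {a b c d : A}
    (h : ((a, b), (c, d)) ∈ DeltaCon S θ (centralizer S ρ θ)) : (a, b) ∈ ρ ↔ (c, d) ∈ ρ := by
  have h' := h _ ⟨isConOn_syntacticConOn hθ.1, fun _ _ => (mem_centralizer_iff hθ).1⟩
  have hmem := (isConOn_syntacticConOn hθ.1).1 h'
  exact (mem_syntacticConOn_iff hθ.1 hmem.1 hmem.2).1 h' _ _ _ _ .base

theorem mem_topt_of_mem_deltaCon [Finite A] (hρ : IsCongruence S ρ) (hθ : IsCongruence S θ)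
    {a b c d : A} (h : ((a, b), (c, d)) ∈ DeltaCon S θ (centralizer S ρ θ)) :
    (a, b, c, d) ∈ Topt S ρ θ := by
  have hmem := (isConOn_deltaCon_centralizer hθ).1 h
  exact ⟨a, b, ⟨hmem.1, hmem.1, hρ.2.refl a, hρ.2.refl b⟩, c, d, h, hmem.2, hmem.2, hρ.2.refl c,
    hρ.2.refl d⟩

theorem isBridgeLR_topt [Finite A] (hρ : IsCongruence S ρ) (hθ : IsCongruence S θ)
    (hlt : ρ ⊂ θ) : IsBridgeLR S ρ ρ θ θ (Topt S ρ θ) := by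
  have hΔ := isConOn_deltaCon_centralizer (ρ := ρ) hθ
  have hid := isSubuniverse_idBridge hρ.1 hθ.1
  have h12 : pr12 (Topt S ρ θ) = θ := by
    ext ⟨a, b⟩
    refine ⟨?_, fun h => ⟨a, b, mem_topt_of_mem_deltaCon hρ hθ (hΔ.2.2.1 _ h)⟩⟩
    rintro ⟨_, _, _, _, h, -⟩
    exact h.1
  have h34 : pr34 (Topt S ρ θ) = θ := by
    ext ⟨a, b⟩
    refine ⟨?_, fun h => ⟨a, b, mem_topt_of_mem_deltaCon hρ hθ (hΔ.2.2.1 _ h)⟩⟩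
    rintro ⟨_, _, _, _, -, _, _, -, h⟩
    exact h.2.1
  have hcomp : ∀ {a b c d : A}, (a, c) ∈ ρ → (b, d) ∈ ρ → ((a, b) ∈ ρ ↔ (c, d) ∈ ρ) :=
    fun h₁ h₂ => ⟨fun h => hρ.2.trans (hρ.2.symm h₁) (hρ.2.trans h h₂),
      fun h => hρ.2.trans h₁ (hρ.2.trans h (hρ.2.symm h₂))⟩
  refine ⟨⟨isSubuniverse_bComp hid (isSubuniverse_bComp (fun o x hx => ?_) hid), ?_, ?_,
    h12.symm ▸ hlt, h34.symm ▸ hlt, ?_⟩, h12, h34⟩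
  · exact hΔ.2.1 o (fun i => (((x i).1, (x i).2.1), ((x i).2.2.1, (x i).2.2.2))) hx
  · rintro a₁ a₂ d₁ d₂ a₁' a₂' ⟨b₁, b₂, ⟨ha, hb, h₁, h₂⟩, h⟩ h₁' h₂'
    exact ⟨b₁, b₂, ⟨hθ.2.trans (hθ.2.symm (hlt.subset h₁')) (hθ.2.trans ha (hlt.subset h₂')), hb,
      hρ.2.trans (hρ.2.symm h₁') h₁, hρ.2.trans (hρ.2.symm h₂') h₂⟩, h⟩
  · rintro a₁ a₂ d₁ d₂ d₁' d₂' ⟨b₁, b₂, h, c₁, c₂, hbc, hc, hd, h₁, h₂⟩ h₁' h₂'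
    exact ⟨b₁, b₂, h, c₁, c₂, hbc, hc,
      hθ.2.trans (hθ.2.symm (hlt.subset h₁')) (hθ.2.trans hd (hlt.subset h₂')),
      hρ.2.trans h₁ h₁', hρ.2.trans h₂ h₂'⟩
  · rintro a₁ a₂ d₁ d₂ ⟨b₁, b₂, ⟨-, -, h₁, h₂⟩, c₁, c₂, hbc, -, -, h₁', h₂'⟩
    exact (hcomp h₁ h₂).trans ((mem_iff_mem_of_mem_deltaCon hθ hbc).trans (hcomp h₁' h₂'))

theorem centralizer_subset_btr_topt [Finite A] (hρ : IsCongruence S ρ) (hθ : IsCongruence S θ) :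
    centralizer S ρ θ ⊆ btr (Topt S ρ θ) := fun ⟨a, b⟩ h =>
  mem_topt_of_mem_deltaCon hρ hθ fun _ hΔ => hΔ.2 a b h

theorem reflBridge_topt [Finite A] (hρ : IsCongruence S ρ) (hθ : IsCongruence S θ) :
    ReflBridge (Topt S ρ θ) := fun a =>
  mem_topt_of_mem_deltaCon hρ hθ ((isConOn_deltaCon_centralizer hθ).2.2.1 _ (hθ.2.refl a))

end Bridge

end Zhuk

/-- in the abelian case, `Cov⁺(ρ) = {ρ⁺}` and `T^opt_{(A,ρ)}` is an
optimal (good) bridge from `(A,ρ)` to itself with trace `Opt(ρ) = (ρ : ρ⁺)`. -/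
theorem stmt_10 {S : Zhuk.Signature} {A : Type} [Zhuk.SAlg S A] [Finite A]
    (hTay : Zhuk.IsTaylorAlg S A)
    (ρ ρplus : Set (A × A)) (hmi : Zhuk.MeetIrredWith S ρ ρplus)
    (hab : Zhuk.Centralizes S ρplus ρplus ρ) :
    Zhuk.CovPlus S ρ ρplus = {ρplus} ∧
    Zhuk.GoodBridge S ρ ρplus ρ ρplus (Zhuk.Topt S ρ ρplus) ∧
    Zhuk.btr (Zhuk.Topt S ρ ρplus) = Zhuk.centralizer S ρ ρplus ∧
    Zhuk.IsOptOf S ρ ρplus (Zhuk.btr (Zhuk.Topt S ρ ρplus)) := by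
  have hcov := hmi.covPlus_eq hTay hab
  obtain ⟨hρ, -, hρplus, hlt, -⟩ := hmi
  have hbridge := Zhuk.isBridgeLR_topt hρ hρplus hlt
  have hrefl := Zhuk.reflBridge_topt hρ hρplus
  have htr : Zhuk.btr (Zhuk.Topt S ρ ρplus) = Zhuk.centralizer S ρ ρplus :=
    (hbridge.btr_subset_centralizer hρplus hrefl).antisymm
      (Zhuk.centralizer_subset_btr_topt hρ hρplus)
  have hmem : ρplus ∈ Zhuk.CovPlus S ρ ρplus := hcov ▸ rfl
  refine ⟨hcov, ⟨hbridge.1, ρplus, hmem, ρplus, hmem, _, subset_rfl, hbridge, rfl⟩, htr,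
    ⟨_, hbridge, hrefl, rfl⟩, ?_⟩
  rintro _ ⟨T, hT, hTrefl, rfl⟩ hle
  exact (htr ▸ hT.btr_subset_centralizer hρplus hTrefl).antisymm hle
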